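/- arXiv:1504.02035 — 4 statements merged into one kernel-verified Lean document; each statement's English description precedes it below -/
import Mathlib

section
/- Let t be odd. If a non-adaptive (m,s,t)-graph G is admissible for sets of size at most n, then the associated non-adaptive t-probe majority query scheme 𝒯_G is satisfiable for every set S ⊆ [m] of size at most n. -/
/-- A non-adaptive `(m,s,t)`-graph: a bipartite graph with vertex sets `U = [m]`
and `V = Fin t × Fin s` (partitioned into the `t` parts `V_i = {i} × Fin s`),
where every `u ∈ U` has exactly one neighbor in each part, namely `(i, nbr i u)`. -/
structure NAGraph (m s t : ℕ) where
  nbr : Fin t → Fin m → Fin s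

/-- The neighborhood `Γ_G(R)` of a set `R ⊆ [m]` in a non-adaptive graph. -/
def NAGraph.Gamma {m s t : ℕ} (G : NAGraph m s t) (R : Set (Fin m)) :
    Set (Fin t × Fin s) :=
  {p | ∃ y ∈ R, G.nbr p.1 y = p.2}

/-- The answer of the non-adaptive `t`-probe majority query scheme `𝒯_G` on
memory `L` for query `u`: Yes iff a (strict) majority of the `t` bits read at
the neighbors of `u` are `1`. -/
def NAGraph.answer {m s t : ℕ} (G : NAGraph m s t) (L : Fin t × Fin s → Bool)
    (u : Fin m) : Bool :=
  decide (t < 2 * (Finset.univ.filter (fun i : Fin t => L (i, G.nbr i u) = true)).card)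

/-- `𝒯_G` is satisfiable for `S` if some memory assignment answers every
membership query "Is `x` in `S`?" correctly. -/
def NAGraph.Satisfiable {m s t : ℕ} (G : NAGraph m s t) (S : Finset (Fin m)) : Prop :=
  ∃ L : Fin t × Fin s → Bool, ∀ x : Fin m, (G.answer L x = true ↔ x ∈ S)

/-- For odd `t`, a non-adaptive `(m,s,t)`-graph `G` is admissible for sets of
size at most `n` if: (P1) every `R ⊆ [m]` with `|R| ≤ n + ⌈2n·log₂(2m/n)⌉`
satisfies `|Γ_G(R)| ≥ ((t+1)/2)·|R|`; and (P2) for every `S ⊆ [m]` with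
`|S| = n`, `|T_S| ≤ ⌈2n·log₂(2m/n)⌉`, where
`T_S = {y ∈ [m]∖S : |Γ_G(y) ∩ Γ_G(S)| ≥ (t+1)/2}`. -/
def NAGraph.Admissible {m s t : ℕ} (G : NAGraph m s t) (n : ℕ) : Prop :=
  (∀ R : Finset (Fin m),
      R.card ≤ n + ⌈2 * (n : ℝ) * Real.logb 2 (2 * (m : ℝ) / (n : ℝ))⌉₊ →
      ((t + 1) / 2) * R.card ≤ (G.Gamma ↑R).ncard) ∧
  (∀ S : Finset (Fin m), S.card = n →
      ({y : Fin m | y ∉ S ∧ (t + 1) / 2 ≤ (G.Gamma {y} ∩ G.Gamma ↑S).ncard}).ncard ≤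
        ⌈2 * (n : ℝ) * Real.logb 2 (2 * (m : ℝ) / (n : ℝ))⌉₊)

namespace NAGraph

variable {m s t : ℕ} (G : NAGraph m s t)

/-- The neighbor of `u` in each part, as a finset. -/
def neighbors (u : Fin m) : Finset (Fin t × Fin s) :=
  Finset.univ.image fun i => (i, G.nbr i u)

lemma mem_neighbors {u : Fin m} {p : Fin t × Fin s} :
    p ∈ G.neighbors u ↔ G.nbr p.1 u = p.2 := by
  obtain ⟨i, v⟩ := p
  simp [neighbors]

lemma Gamma_mono {R R' : Set (Fin m)} (h : R ⊆ R') : G.Gamma R ⊆ G.Gamma R' := by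
  rintro p ⟨y, hy, hp⟩
  exact ⟨y, h hy, hp⟩

/-- Hall's theorem: if every `R ⊆ W` has at least `k * |R|` neighbors, then the elements of `W`
can be assigned pairwise disjoint sets of `k` neighbors each. -/
lemma exists_injective_mem_neighbors (k : ℕ) (W : Finset (Fin m))
    (hW : ∀ R ⊆ W, k * R.card ≤ (G.Gamma ↑R).ncard) :
    ∃ f : W × Fin k → Fin t × Fin s,
      Function.Injective f ∧ ∀ q, f q ∈ G.neighbors q.1 := by
  classical
  refine (Finset.all_card_le_biUnion_card_iff_exists_injective
    (fun q : W × Fin k => G.neighbors q.1)).1 fun A => ?_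
  let B : Finset W := A.image Prod.fst
  let R : Finset (Fin m) := B.map (Function.Embedding.subtype _)
  have hR : R ⊆ W := by
    intro x hx
    obtain ⟨y, -, rfl⟩ := Finset.mem_map.1 hx
    exact y.2
  have hA : A.card ≤ k * R.card := by
    have hsub : A ⊆ B ×ˢ Finset.univ := fun q hq =>
      Finset.mem_product.2 ⟨Finset.mem_image_of_mem _ hq, Finset.mem_univ _⟩
    calc A.card ≤ (B ×ˢ (Finset.univ : Finset (Fin k))).card := Finset.card_le_card hsub
      _ = k * R.card := by simp [R, Finset.card_product, mul_comm]
  have hG : G.Gamma ↑R ⊆ ↑(A.biUnion fun q => G.neighbors q.1) := by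
    rintro p ⟨y, hy, hp⟩
    obtain ⟨z, hz, rfl⟩ := Finset.mem_map.1 (Finset.mem_coe.1 hy)
    obtain ⟨q, hq, rfl⟩ := Finset.mem_image.1 hz
    exact Finset.mem_coe.2 (Finset.mem_biUnion.2 ⟨q, hq, G.mem_neighbors.2 hp⟩)
  calc A.card ≤ k * R.card := hA
    _ ≤ (G.Gamma ↑R).ncard := hW R hR
    _ ≤ (A.biUnion fun q => G.neighbors q.1).card := by
      simpa only [Set.ncard_coe_finset] using Set.ncard_le_ncard hG (Finset.finite_toSet _)

lemma le_card_filter_of_injective {k : ℕ} {x : Fin m} (L : Fin t × Fin s → Bool) (b : Bool)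
    {g : Fin k → Fin t × Fin s} (hg : Function.Injective g)
    (hmem : ∀ j, g j ∈ G.neighbors x) (hL : ∀ j, L (g j) = b) :
    k ≤ (Finset.univ.filter fun i : Fin t => L (i, G.nbr i x) = b).card := by
  have hg' : ∀ j, ((g j).1, G.nbr (g j).1 x) = g j := fun j =>
    Prod.ext rfl (G.mem_neighbors.1 (hmem j))
  have := Finset.card_le_card_of_injOn (s := (Finset.univ : Finset (Fin k)))
    (t := Finset.univ.filter fun i : Fin t => L (i, G.nbr i x) = b) (fun j => (g j).1)
    (fun j _ => by simp [hg', hL])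
    (fun a _ c _ h => hg (by rw [← hg' a, ← hg' c]; exact congrArg (fun i => (i, G.nbr i x)) h))
  simpa using this

lemma card_filter_le_ncard_inter {S : Set (Fin m)} {L : Fin t × Fin s → Bool}
    (hL : ∀ p, L p = true → p ∈ G.Gamma S) (x : Fin m) :
    (Finset.univ.filter fun i : Fin t => L (i, G.nbr i x) = true).card ≤
      (G.Gamma {x} ∩ G.Gamma S).ncard := by
  rw [← Set.ncard_coe_finset]
  refine Set.ncard_le_ncard_of_injOn (fun i => (i, G.nbr i x)) (fun i hi => ?_)
    (fun i _ j _ h => congrArg Prod.fst h) (Set.toFinite _)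
  exact ⟨⟨x, rfl, rfl⟩, hL _ (by simpa using hi)⟩

/-- If the elements of `W ⊇ S` expand by a factor `(t + 1) / 2` and no element outside `W` has
a majority of its neighbors in `Γ_G(S)`, then the majority scheme is satisfiable for `S`. -/
lemma satisfiable_of_expansion (ht : Odd t) {S W : Finset (Fin m)} (hSW : S ⊆ W)
    (hW : ∀ R ⊆ W, ((t + 1) / 2) * R.card ≤ (G.Gamma ↑R).ncard)
    (hout : ∀ y ∉ W, (G.Gamma {y} ∩ G.Gamma ↑S).ncard < (t + 1) / 2) :
    G.Satisfiable S := by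
  classical
  obtain ⟨f, hf, hmem⟩ := G.exists_injective_mem_neighbors _ W hW
  obtain ⟨r, rfl⟩ := ht
  let L : Fin (2 * r + 1) × Fin s → Bool := fun p => decide (∃ q, (q.1 : Fin m) ∈ S ∧ f q = p)
  have hLf : ∀ q, L (f q) = decide ((q.1 : Fin m) ∈ S) := fun q => by
    simp only [L, decide_eq_decide]
    exact ⟨fun ⟨q', h, e⟩ => hf e ▸ h, fun h => ⟨q, h, rfl⟩⟩
  have hLS : ∀ p, L p = true → p ∈ G.Gamma ↑S := fun p hp => by
    obtain ⟨q, hq, rfl⟩ := of_decide_eq_true hp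
    exact ⟨q.1, hq, G.mem_neighbors.1 (hmem q)⟩
  have hcount (x : Fin m) (hx : x ∈ W) := G.le_card_filter_of_injective L (decide (x ∈ S))
    (g := fun j => f (⟨x, hx⟩, j)) (fun a c h => (Prod.ext_iff.1 (hf h)).2)
    (fun j => hmem _) (fun j => hLf _)
  refine ⟨L, fun x => ?_⟩
  rw [answer, decide_eq_true_iff]
  by_cases hxS : x ∈ S
  · have h := hcount x (hSW hxS)
    rw [decide_eq_true hxS] at h
    simp only [hxS, iff_true]
    omega
  · simp only [hxS, iff_false, not_lt]
    by_cases hxW : x ∈ W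
    · have h := hcount x hxW
      rw [decide_eq_false hxS] at h
      have hsum := Finset.card_filter_add_card_filter_not (s := Finset.univ)
        fun i : Fin (2 * r + 1) => L (i, G.nbr i x) = true
      simp only [Bool.not_eq_true, Finset.card_univ, Fintype.card_fin] at hsum
      omega
    · have h := G.card_filter_le_ncard_inter hLS x
      have := hout x hxW
      omega

end NAGraph

/-- Let `t` be odd. If a non-adaptive `(m,s,t)`-graph `G` is admissible for sets
of size at most `n`, then the associated non-adaptive `t`-probe majority query
scheme `𝒯_G` is satisfiable for every set `S ⊆ [m]` of size at most `n`. -/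
theorem na_admissible_implies_satisfiable {m s t n : ℕ} (ht : Odd t)
    (G : NAGraph m s t) (hG : G.Admissible n) :
    ∀ S : Finset (Fin m), S.card ≤ n → G.Satisfiable S := by
  classical
  obtain ⟨hexp, hT⟩ := hG
  intro S hS
  by_cases hn : n ≤ m
  · obtain ⟨S', hSS', hS'⟩ := Finset.exists_superset_card_eq hS (by simpa using hn)
    let T : Finset (Fin m) := Finset.univ.filter fun y =>
      y ∉ S' ∧ (t + 1) / 2 ≤ (G.Gamma {y} ∩ G.Gamma ↑S').ncard
    have hTcard := hT S' hS'
    rw [show {y : Fin m | y ∉ S' ∧ (t + 1) / 2 ≤ (G.Gamma {y} ∩ G.Gamma ↑S').ncard} = ↑T by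
      ext; simp [T], Set.ncard_coe_finset] at hTcard
    refine G.satisfiable_of_expansion ht (hSS'.trans Finset.subset_union_left : S ⊆ S' ∪ T)
      (fun R hR => hexp R ?_) (fun y hy => ?_)
    · have h₁ := Finset.card_le_card hR
      have h₂ := Finset.card_union_le S' T
      omega
    · simp only [T, Finset.mem_union, Finset.mem_filter, Finset.mem_univ, true_and, not_or,
        not_and, not_le] at hy
      exact (Set.ncard_le_ncard (Set.inter_subset_inter_right _
        (G.Gamma_mono (Finset.coe_subset.2 hSS'))) (Set.toFinite _)).trans_lt (hy.2 hy.1)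
  · refine G.satisfiable_of_expansion ht (Finset.subset_univ S) (fun R _ => hexp R ?_)
      (fun y hy => absurd (Finset.mem_univ y) hy)
    have := Finset.card_le_univ R
    rw [Fintype.card_fin] at this
    omega
end

section
/- For every odd integer t ≥ 5, for all sufficiently large m and all integers n with 1 ≤ n ≤ m, there exists a non-adaptive (m,s,t)-graph with s = ⌈60 · m^{2/(t−1)} · n^{1 − 2/(t−1)} · log₂(2m/n)⌉ that is admissible for sets of size at most n. -/
section AdmissibleGraphs

open Finset

/-- Number of colourings in which every point of `Y` repeats the colour of a point of its
associated set outside `Y`. -/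
theorem card_repeating_mul_le {α β : Type*} [Fintype α] [DecidableEq α] [Fintype β]
    [DecidableEq β] (Y : Finset α) (Z : α → Finset α) (d : ℕ)
    (hZ : ∀ a ∈ Y, Disjoint (Z a) Y) (hd : ∀ a ∈ Y, #(Z a) ≤ d) :
    #{f : α → β | ∀ a ∈ Y, ∃ b ∈ Z a, f b = f a} * Fintype.card β ^ #Y ≤
      d ^ #Y * Fintype.card β ^ Fintype.card α := by
  classical
  have key : #{f : α → β | ∀ a ∈ Y, ∃ b ∈ Z a, f b = f a} ≤
      Fintype.card ((↥(Yᶜ) → β) × ((a : Y) → Z a)) := by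
    rw [← Fintype.card_coe]
    have hc : ∀ f : {f // f ∈ ({f : α → β | ∀ a ∈ Y, ∃ b ∈ Z a, f b = f a} : Finset _)},
        ∀ a : Y, ∃ b : Z a, f.1 b = f.1 a := by
      rintro ⟨f, hf⟩ a
      obtain ⟨b, hb, h⟩ := (mem_filter.1 hf).2 a a.2
      exact ⟨⟨b, hb⟩, h⟩
    choose g hg using hc
    refine Fintype.card_le_of_injective (fun f => (fun x => f.1 x, g f)) ?_
    intro f f' h
    simp only [Prod.mk.injEq] at h
    have h1 : ∀ x, x ∉ Y → f.1 x = f'.1 x := fun x hx =>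
      congrFun h.1 ⟨x, by simpa using hx⟩
    refine Subtype.ext (funext fun x => ?_)
    by_cases hx : x ∈ Y
    · rw [← hg f ⟨x, hx⟩, ← hg f' ⟨x, hx⟩, h.2]
      exact h1 _ (disjoint_left.1 (hZ x hx) (g f' ⟨x, hx⟩).2)
    · exact h1 x hx
  have hcard : Fintype.card ((↥(Yᶜ) → β) × ((a : Y) → Z a)) ≤
      Fintype.card β ^ #(Yᶜ) * d ^ #Y := by
    rw [Fintype.card_prod, Fintype.card_pi, Fintype.card_pi]
    simp only [prod_const, Fintype.card_coe, card_univ]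
    gcongr
    calc ∏ a : Y, #(Z a) ≤ ∏ _a : Y, d := prod_le_prod' fun a _ => hd a a.2
      _ = d ^ #Y := by simp
  calc _ ≤ Fintype.card β ^ #(Yᶜ) * d ^ #Y * Fintype.card β ^ #Y := by
        gcongr; exact key.trans hcard
    _ = d ^ #Y * Fintype.card β ^ (#(Yᶜ) + #Y) := by ring
    _ = _ := by rw [card_compl_add_card]

theorem choose_le_three_mul_div_pow (m r : ℕ) (hr : 1 ≤ r) :
    (m.choose r : ℝ) ≤ (3 * m / r) ^ r := by
  have h1 : (m.choose r : ℝ) ≤ (m : ℝ) ^ r / r.factorial := Nat.choose_le_pow_div r m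
  have h2 : (r : ℝ) ^ r / r.factorial ≤ 3 ^ r := by
    calc (r : ℝ) ^ r / r.factorial ≤ Real.exp r := Real.pow_div_factorial_le_exp _ (by positivity) _
      _ = Real.exp 1 ^ r := by rw [← Real.exp_nat_mul, mul_one]
      _ ≤ 3 ^ r := by
        gcongr; exact Real.exp_one_lt_three.le
  have hr' : (0 : ℝ) < r := by exact_mod_cast hr
  calc (m.choose r : ℝ) ≤ (m : ℝ) ^ r / r.factorial := h1
    _ = (m / r : ℝ) ^ r * ((r : ℝ) ^ r / r.factorial) := by
        rw [div_pow]; field_simp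
    _ ≤ (m / r : ℝ) ^ r * 3 ^ r := by gcongr
    _ = (3 * m / r) ^ r := by rw [← mul_pow]; congr 1; ring

/-- Few neighbours force many repetitions. -/
theorem NAGraph.exists_repetitions_of_ncard_Gamma_lt {m s k : ℕ}
    (G : NAGraph m s (2 * k + 1)) (R : Finset (Fin m))
    (h : (G.Gamma ↑R).ncard < (k + 1) * #R) :
    ∃ Y ∈ powersetCard (k * #R) ((univ : Finset (Fin (2 * k + 1))) ×ˢ R),
      ∀ a ∈ Y, ∃ b ∈ (R.image fun u => (a.1, u)) \ Y, G.nbr b.1 b.2 = G.nbr a.1 a.2 := by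
  classical
  set P := (univ : Finset (Fin (2 * k + 1))) ×ˢ R with hP
  set φ : Fin (2 * k + 1) × Fin m → Fin (2 * k + 1) × Fin s :=
    fun a => (a.1, G.nbr a.1 a.2) with hφ
  have hΓ : G.Gamma ↑R = ↑(P.image φ) := by
    ext ⟨i, j⟩
    simp only [NAGraph.Gamma, Set.mem_ofPred_eq, coe_image, Set.mem_image, mem_coe, hP, hφ,
      mem_product, mem_univ, true_and, Prod.exists, Prod.mk.injEq]
    constructor
    · rintro ⟨y, hy, rfl⟩; exact ⟨i, y, hy, rfl, rfl⟩
    · rintro ⟨i', y, hy, rfl, rfl⟩; exact ⟨y, hy, rfl⟩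
  rw [hΓ, Set.ncard_coe_finset] at h
  obtain ⟨P', hP', hinj, himg⟩ : ∃ P' ⊆ P, Set.InjOn φ P' ∧ P'.image φ = P.image φ :=
    exists_subset_injOn_image_eq_of_surjOn _ _ (by rw [coe_image]; exact Set.surjOn_image _ _)
  have hcP : #P = (2 * k + 1) * #R := by simp [hP, card_product]
  have hc' : #P' = #(P.image φ) := by rw [← himg, card_image_of_injOn hinj]
  have hle : k * #R ≤ #(P \ P') := by
    rw [card_sdiff_of_subset hP', hcP, hc']
    have : (2 * k + 1) * #R = k * #R + (k + 1) * #R := by ring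
    omega
  obtain ⟨Y, hY, hYc⟩ := exists_subset_card_eq hle
  refine ⟨Y, mem_powersetCard.2 ⟨hY.trans sdiff_subset, hYc⟩, fun a ha => ?_⟩
  have haP := (mem_sdiff.1 (hY ha)).1
  obtain ⟨b, hb, hba⟩ := mem_image.1 (himg ▸ mem_image_of_mem φ haP)
  simp only [hφ, Prod.mk.injEq] at hba
  refine ⟨b, mem_sdiff.2 ⟨mem_image.2 ⟨b.2, (mem_product.1 (hP' hb)).2, ?_⟩, fun hbY =>
    (mem_sdiff.1 (hY hbY)).2 hb⟩, hba.2⟩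
  rw [← hba.1]

/-- Many points outside `S` sharing a majority of neighbours with `S` force many repetitions. -/
theorem NAGraph.exists_repetitions_of_lt_ncard {m s k : ℕ}
    (G : NAGraph m s (2 * k + 1)) (S : Finset (Fin m)) (q : ℕ)
    (h : q ≤ ({y : Fin m | y ∉ S ∧ k + 1 ≤ (G.Gamma {y} ∩ G.Gamma ↑S).ncard}).ncard) :
    ∃ T ∈ powersetCard q (univ : Finset (Fin m)), Disjoint S T ∧
      ∃ Y ∈ powersetCard ((k + 1) * q) ((univ : Finset (Fin (2 * k + 1))) ×ˢ T),
      ∀ a ∈ Y, ∃ b ∈ S.image fun u => ((a : Fin (2 * k + 1) × Fin m).1, u), G.nbr b.1 b.2 = G.nbr a.1 a.2 := by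
  classical
  rw [Set.ncard_eq_toFinset_card'] at h
  obtain ⟨T, hT, hTc⟩ := exists_subset_card_eq h
  have hT' : ∀ y ∈ T, y ∉ S ∧ k + 1 ≤ (G.Gamma {y} ∩ G.Gamma ↑S).ncard := fun y hy => by
    simpa using hT hy
  set Y₀ := ((univ : Finset (Fin (2 * k + 1))) ×ˢ T).filter
    (fun a : Fin (2 * k + 1) × Fin m => ∃ u ∈ S, G.nbr a.1 u = G.nbr a.1 a.2) with hY₀
  have hfib : ∀ y ∈ T, k + 1 ≤ #(Y₀.filter fun a => a.2 = y) := by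
    intro y hy
    refine (hT' y hy).2.trans ?_
    rw [← Set.ncard_coe_finset]
    refine (Set.ncard_le_ncard (t := (fun a : Fin (2 * k + 1) × Fin m => (a.1, G.nbr a.1 a.2)) ''
      (↑(Y₀.filter fun a => a.2 = y) : Set _)) ?_ (Set.toFinite _)).trans
      (Set.ncard_image_le (Set.toFinite _))
    rintro ⟨i, j⟩ ⟨⟨y', hy', h1⟩, u, hu, h2⟩
    obtain rfl : y' = y := hy'
    simp only at h1 h2
    refine ⟨(i, y'), ?_, by simp [h1]⟩
    simp only [hY₀, coe_filter, Set.mem_ofPred_eq, mem_filter, mem_product, mem_univ, true_and,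
      and_true]
    exact ⟨hy, u, hu, h2.trans h1.symm⟩
  have hle : (k + 1) * q ≤ #Y₀ := by
    rw [card_eq_sum_card_fiberwise (f := Prod.snd) (t := T)
      (fun a ha => (mem_product.1 (mem_filter.1 ha).1).2), mul_comm, ← hTc, ← smul_eq_mul]
    exact card_nsmul_le_sum _ _ _ hfib
  obtain ⟨Y, hY, hYc⟩ := exists_subset_card_eq hle
  refine ⟨T, mem_powersetCard.2 ⟨subset_univ _, hTc⟩,
    disjoint_right.2 fun y hy => (hT' y hy).1, Y,
    mem_powersetCard.2 ⟨hY.trans (filter_subset _ _), hYc⟩, fun a ha => ?_⟩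
  obtain ⟨u, hu, h⟩ := (mem_filter.1 (hY ha)).2
  exact ⟨(a.1, u), mem_image_of_mem _ hu, h⟩

theorem repetition_term_le {k n m r : ℕ} {L s : ℝ} (hk : 2 ≤ k)
    (hL : 1 ≤ L) (hs : 60 ^ k * m * n ^ (k - 1) * L ^ k ≤ s ^ k) (hs0 : 0 < s) (hr : 1 ≤ r)
    (hrn : r ≤ 4 * n * L) :
    (m.choose r : ℝ) * (2 ^ ((2 * k + 1) * r) * (r / s) ^ (k * r)) ≤ (1 / 4) ^ r := by
  have hr' : (0 : ℝ) < r := by exact_mod_cast hr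
  have hbase : (3 * m / r : ℝ) * (2 ^ (2 * k + 1) * (r / s) ^ k) ≤ 1 / 4 := by
    obtain ⟨j, rfl⟩ : ∃ j, k = j + 1 := ⟨k - 1, by omega⟩
    rw [Nat.add_sub_cancel] at hs
    have h1 : (24 : ℝ) * 4 ^ (j + 1) * m * r ^ j ≤ s ^ (j + 1) := by
      refine le_trans ?_ hs
      have h15 : (6 : ℝ) * 16 ^ (j + 1) ≤ 60 ^ (j + 1) := by
        have : (6 : ℝ) ≤ (15 / 4) ^ (j + 1) :=
          le_trans (by norm_num) (pow_le_pow_right₀ (by norm_num : (1 : ℝ) ≤ 15 / 4) hk)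
        calc (6 : ℝ) * 16 ^ (j + 1) ≤ (15 / 4) ^ (j + 1) * 16 ^ (j + 1) := by gcongr
          _ = 60 ^ (j + 1) := by rw [← mul_pow]; norm_num
      calc (24 : ℝ) * 4 ^ (j + 1) * m * r ^ j
          ≤ 24 * 4 ^ (j + 1) * m * (4 * n * L) ^ j := by gcongr
        _ = (6 * (4 ^ (j + 1) * 4 ^ (j + 1))) * m * n ^ j * L ^ j := by ring
        _ = (6 * 16 ^ (j + 1)) * m * n ^ j * L ^ j := by rw [← mul_pow]; norm_num
        _ ≤ 60 ^ (j + 1) * m * n ^ j * L ^ (j + 1) := by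
          gcongr
          · omega
    have h2 : (3 * m / r : ℝ) * (2 ^ (2 * (j + 1) + 1) * (r / s) ^ (j + 1)) =
        (24 * 4 ^ (j + 1) * m * r ^ j) / s ^ (j + 1) / 4 := by
      rw [pow_succ 2, pow_mul, div_pow]
      field_simp
      norm_num
      ring
    rw [h2]
    have := (div_le_one (pow_pos hs0 (j + 1))).2 h1
    linarith
  calc (m.choose r : ℝ) * (2 ^ ((2 * k + 1) * r) * (r / s) ^ (k * r))
      ≤ (3 * m / r) ^ r * (2 ^ ((2 * k + 1) * r) * (r / s) ^ (k * r)) := by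
        gcongr
        exact choose_le_three_mul_div_pow m r hr
    _ = ((3 * m / r : ℝ) * (2 ^ (2 * k + 1) * (r / s) ^ k)) ^ r := by
        simp only [mul_pow, ← pow_mul]
    _ ≤ (1 / 4) ^ r := by gcongr

theorem choose_mul_quarter_pow_le {n m q : ℕ} (hn : 1 ≤ n) (hm : n ≤ m)
    (hq : 2 * n * Real.logb 2 (2 * m / n) ≤ q) :
    (m.choose n : ℝ) * (1 / 4) ^ q ≤ 1 / 4 := by
  have hn' : (0 : ℝ) < n := by exact_mod_cast hn
  have hm' : (n : ℝ) ≤ m := by exact_mod_cast hm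
  set X : ℝ := 2 * m / n with hX
  have hX2 : 2 ≤ X := by rw [hX, le_div_iff₀ hn']; linarith
  have hq' : (1 / 4 : ℝ) ^ q ≤ ((X ^ 4)⁻¹) ^ n := by
    calc (1 / 4 : ℝ) ^ q = (1 / 4 : ℝ) ^ (q : ℝ) := (Real.rpow_natCast _ _).symm
      _ ≤ (1 / 4 : ℝ) ^ (2 * n * Real.logb 2 X) :=
        Real.rpow_le_rpow_of_exponent_ge (by norm_num) (by norm_num) hq
      _ = ((2 : ℝ) ^ (-2 : ℝ)) ^ (2 * n * Real.logb 2 X) := by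
        congr 1; rw [Real.rpow_neg (by norm_num)]; norm_num
      _ = ((2 : ℝ) ^ Real.logb 2 X) ^ (-((4 * n : ℕ) : ℝ)) := by
        rw [← Real.rpow_mul (by norm_num), ← Real.rpow_mul (by norm_num)]
        congr 1; push_cast; ring
      _ = ((X ^ 4)⁻¹) ^ n := by
        rw [Real.rpow_logb (by norm_num) (by norm_num) (by linarith),
          Real.rpow_neg (by linarith), Real.rpow_natCast, pow_mul, inv_pow]
  have hb : 3 / 2 * X * (X ^ 4)⁻¹ ≤ 1 / 4 := by
    have h3 : (2 : ℝ) ^ 3 ≤ X ^ 3 := by gcongr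
    have : 3 / 2 * X * (X ^ 4)⁻¹ = 3 / 2 / X ^ 3 := by field_simp
    rw [this, div_le_iff₀ (by positivity)]
    linarith
  calc (m.choose n : ℝ) * (1 / 4) ^ q ≤ (3 * m / n) ^ n * ((X ^ 4)⁻¹) ^ n := by
        gcongr
        exact choose_le_three_mul_div_pow m n hn
    _ = (3 / 2 * X * (X ^ 4)⁻¹) ^ n := by rw [← mul_pow, hX]; congr 2; ring
    _ ≤ (1 / 4) ^ n := by gcongr
    _ ≤ 1 / 4 := pow_le_of_le_one (by norm_num) (by norm_num) (by omega)

theorem majority_term_le {k n m q : ℕ} {L s : ℝ} (hk : 1 ≤ k) (hn : 1 ≤ n) (hm : n ≤ m)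
    (hL : 1 ≤ L) (hs : 60 ^ k * m * n ^ (k - 1) * L ^ k ≤ s ^ k) (hs0 : 0 < s)
    (hq : n ≤ q) :
    (m.choose q : ℝ) * (2 ^ ((2 * k + 1) * q) * (n / s) ^ ((k + 1) * q)) ≤ (1 / 4) ^ q := by
  have hn' : (0 : ℝ) < n := by exact_mod_cast hn
  have hm' : (n : ℝ) ≤ m := by exact_mod_cast hm
  have hq' : (n : ℝ) ≤ q := by exact_mod_cast hq
  have hq0 : (0 : ℝ) < q := hn'.trans_le hq'
  have hsk : 60 ^ k * m * n ^ (k - 1) ≤ s ^ k :=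
    le_trans (le_mul_of_one_le_right (by positivity) (one_le_pow₀ hL)) hs
  have hs60 : 60 * n ≤ s := by
    refine le_of_pow_le_pow_left₀ (by omega : k ≠ 0) hs0.le (le_trans ?_ hsk)
    calc (60 * n : ℝ) ^ k = 60 ^ k * n * n ^ (k - 1) := by
          rw [mul_pow, mul_assoc, mul_pow_sub_one (by omega)]
      _ ≤ _ := by gcongr
  have hbase : (3 * m / q : ℝ) * (2 ^ (2 * k + 1) * (n / s) ^ (k + 1)) ≤ 1 / 4 := by
    have h1 : (24 : ℝ) * 4 ^ k * m * n ^ (k + 1) ≤ q * s ^ (k + 1) := by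
      calc (24 : ℝ) * 4 ^ k * m * n ^ (k + 1)
          ≤ 60 * 60 ^ k * m * n ^ (k + 1) := by gcongr <;> norm_num
        _ = n * (60 ^ k * m * n ^ (k - 1) * (60 * n)) := by
          obtain ⟨j, rfl⟩ : ∃ j, k = j + 1 := ⟨k - 1, by omega⟩
          rw [Nat.add_sub_cancel]; ring
        _ ≤ q * (s ^ k * s) := by gcongr
        _ = q * s ^ (k + 1) := by ring
    have h2 : (3 * m / q : ℝ) * (2 ^ (2 * k + 1) * (n / s) ^ (k + 1)) =
        (24 * 4 ^ k * m * n ^ (k + 1)) / (q * s ^ (k + 1)) / 4 := by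
      rw [pow_succ 2, pow_mul, div_pow]
      field_simp
      ring
    rw [h2]
    have := (div_le_one (mul_pos hq0 (pow_pos hs0 (k + 1)))).2 h1
    linarith
  calc (m.choose q : ℝ) * (2 ^ ((2 * k + 1) * q) * (n / s) ^ ((k + 1) * q))
      ≤ (3 * m / q) ^ q * (2 ^ ((2 * k + 1) * q) * (n / s) ^ ((k + 1) * q)) := by
        gcongr
        exact choose_le_three_mul_div_pow m q (by omega)
    _ = ((3 * m / q : ℝ) * (2 ^ (2 * k + 1) * (n / s) ^ (k + 1))) ^ q := by
        simp only [mul_pow, ← pow_mul]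
    _ ≤ (1 / 4) ^ q := by gcongr

theorem sum_quarter_pow_le (B : ℕ) : ∑ r ∈ Icc 1 B, (1 / 4 : ℝ) ^ r ≤ 1 / 3 := by
  have h : ∑ r ∈ Icc 1 B, (1 / 4 : ℝ) ^ r = (1 - (1 / 4) ^ B) / 3 := by
    induction B with
    | zero => simp
    | succ B ih => rw [sum_Icc_succ_top (by omega), ih]; ring
  rw [h]
  have : (0 : ℝ) ≤ (1 / 4) ^ B := by positivity
  linarith

theorem card_filter_exists_le {ι Ω : Type*} [Fintype Ω] (A : Finset ι) (p : ι → Ω → Prop)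
    [∀ i, DecidablePred (p i)] [DecidablePred fun f => ∃ i ∈ A, p i f] (c : ℝ)
    (h : ∀ i ∈ A, (#{f | p i f} : ℝ) ≤ c) :
    (#{f | ∃ i ∈ A, p i f} : ℝ) ≤ #A * c := by
  classical
  have : ({f | ∃ i ∈ A, p i f} : Finset Ω) ⊆ A.biUnion fun i => {f | p i f} := by
    intro f hf
    simpa using hf
  calc (#{f | ∃ i ∈ A, p i f} : ℝ) ≤ (∑ i ∈ A, #{f | p i f} : ℕ) := by
        exact_mod_cast (card_le_card this).trans card_biUnion_le
    _ = ∑ i ∈ A, (#{f | p i f} : ℝ) := by push_cast; rfl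
    _ ≤ #A * c := by rw [← nsmul_eq_mul]; exact sum_le_card_nsmul _ _ _ h

/-- Union bound over the sets of repeating points. -/
theorem card_exists_repeating_le {α β : Type*} [Fintype α] [DecidableEq α] [Fintype β]
    [DecidableEq β] [Nonempty β] (P : Finset α) (j d : ℕ) (Z : Finset α → α → Finset α)
    (hZ : ∀ Y ∈ powersetCard j P, ∀ a ∈ Y, Disjoint (Z Y a) Y)
    (hd : ∀ Y ∈ powersetCard j P, ∀ a ∈ Y, #(Z Y a) ≤ d) :
    (#{f : α → β | ∃ Y ∈ powersetCard j P, ∀ a ∈ Y, ∃ b ∈ Z Y a, f b = f a} : ℝ) ≤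
      2 ^ #P * (d / Fintype.card β) ^ j * Fintype.card (α → β) := by
  have hβ : (0 : ℝ) < Fintype.card β := by exact_mod_cast Fintype.card_pos
  refine (card_filter_exists_le _ _ ((d / Fintype.card β) ^ j * Fintype.card (α → β))
    fun Y hY => ?_).trans ?_
  · have h := card_repeating_mul_le (β := β) Y (Z Y) d (hZ Y hY) (hd Y hY)
    rw [(mem_powersetCard.1 hY).2] at h
    rw [div_pow, div_mul_eq_mul_div, le_div_iff₀ (by positivity), Fintype.card_fun]
    exact_mod_cast h
  · rw [card_powersetCard, mul_assoc]
    gcongr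
    exact_mod_cast Nat.choose_le_two_pow _ _

theorem NAGraph.exists_admissible {k n m s : ℕ} (hk : 2 ≤ k) (hn : 1 ≤ n) (hm : n ≤ m)
    (hs : (60 : ℝ) ^ k * m * n ^ (k - 1) * Real.logb 2 (2 * m / n) ^ k ≤ s ^ k) (hs0 : 0 < s) :
    ∃ G : NAGraph m s (2 * k + 1), G.Admissible n := by
  classical
  have hn' : (1 : ℝ) ≤ n := by exact_mod_cast hn
  have hm' : (n : ℝ) ≤ m := by exact_mod_cast hm
  have hs' : (0 : ℝ) < s := by exact_mod_cast hs0
  have : Nonempty (Fin s) := ⟨⟨0, hs0⟩⟩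
  set L : ℝ := Real.logb 2 (2 * m / n) with hLdef
  have hL : 1 ≤ L := by
    rw [hLdef, Real.le_logb_iff_rpow_le (by norm_num)
      (div_pos (by linarith) (by linarith)), Real.rpow_one,
      le_div_iff₀ (by linarith)]
    linarith
  have hnL : (n : ℝ) ≤ n * L := le_mul_of_one_le_right (by linarith) hL
  set Q : ℕ := ⌈2 * (n : ℝ) * L⌉₊ with hQ
  have hQ1 : 2 * (n : ℝ) * L ≤ Q := Nat.le_ceil _
  have hQ2 : (Q : ℝ) < 2 * (n : ℝ) * L + 1 := Nat.ceil_lt_add_one (by positivity)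
  set Ω := Fin (2 * k + 1) × Fin m → Fin s with hΩ
  set N : ℝ := ((Fintype.card Ω : ℕ) : ℝ) with hN
  have hN0 : 0 < N := by rw [hN]; exact_mod_cast Fintype.card_pos
  set row : Finset (Fin m) → Fin (2 * k + 1) × Fin m → Finset (Fin (2 * k + 1) × Fin m) :=
    fun U a => U.image fun u => (a.1, u)
  have hrowc : ∀ U a, #(row U a) ≤ #U := fun U a => card_image_le
  let bad₁ (r : ℕ) : Finset Ω := {f | ∃ R ∈ powersetCard r (univ : Finset (Fin m)),
    ∃ Y ∈ powersetCard (k * r) ((univ : Finset (Fin (2 * k + 1))) ×ˢ R),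
      ∀ a ∈ Y, ∃ b ∈ row R a \ Y, f b = f a}
  let bad₂ : Finset Ω := {f | ∃ S ∈ powersetCard n (univ : Finset (Fin m)),
    ∃ T ∈ {T ∈ powersetCard (Q + 1) (univ : Finset (Fin m)) | Disjoint S T},
    ∃ Y ∈ powersetCard ((k + 1) * (Q + 1)) ((univ : Finset (Fin (2 * k + 1))) ×ˢ T),
      ∀ a ∈ Y, ∃ b ∈ row S a, f b = f a}
  have h₁ : ∀ r ∈ Icc 1 (n + Q), (#(bad₁ r) : ℝ) ≤ (1 / 4) ^ r * N := by
    intro r hr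
    obtain ⟨hr1, hr2⟩ := mem_Icc.1 hr
    have hr2' : (r : ℝ) ≤ n + Q := by exact_mod_cast hr2
    have hterm := repetition_term_le (n := n) (m := m) hk hL hs hs' hr1 (by linarith)
    refine (card_filter_exists_le _ _ (2 ^ ((2 * k + 1) * r) * (r / s) ^ (k * r) * N)
      fun R hR => ?_).trans ?_
    · have hRc := (mem_powersetCard.1 hR).2
      have h := card_exists_repeating_le (β := Fin s)
        ((univ : Finset (Fin (2 * k + 1))) ×ˢ R) (k * r) r
        (fun Y a => row R a \ Y) (fun Y _ a _ => sdiff_disjoint)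
        (fun Y _ a _ => (card_le_card sdiff_subset).trans ((hrowc R a).trans hRc.le))
      rwa [card_product, hRc, card_univ, Fintype.card_fin, Fintype.card_fin] at h
    · rw [card_powersetCard, card_univ, Fintype.card_fin, ← mul_assoc]
      gcongr
  have h₂ : (#bad₂ : ℝ) ≤ 1 / 4 * N := by
    have hQ1' : 2 * (n : ℝ) * L ≤ (Q + 1 : ℕ) := by push_cast; linarith
    have hnq : n ≤ Q + 1 := by
      have : (n : ℝ) ≤ (Q + 1 : ℕ) := by linarith
      exact_mod_cast this
    have hterm := majority_term_le (by omega) hn hm hL hs hs' hnq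
    have hchoose := choose_mul_quarter_pow_le hn hm hQ1'
    refine (card_filter_exists_le _ _ ((1 / 4) ^ (Q + 1) * N) fun S hS => ?_).trans ?_
    · have hSc := (mem_powersetCard.1 hS).2
      refine (card_filter_exists_le _ _
        (2 ^ ((2 * k + 1) * (Q + 1)) * (n / s) ^ ((k + 1) * (Q + 1)) * N)
        fun T hT => ?_).trans ?_
      · obtain ⟨hT, hST⟩ := mem_filter.1 hT
        have hTc := (mem_powersetCard.1 hT).2
        have h := card_exists_repeating_le (β := Fin s)
          ((univ : Finset (Fin (2 * k + 1))) ×ˢ T) ((k + 1) * (Q + 1)) n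
          (fun _ a => row S a) (fun Y hY a _ => by
            refine disjoint_left.2 fun b hb hbY => ?_
            obtain ⟨u, hu, rfl⟩ := mem_image.1 hb
            exact disjoint_left.1 hST hu
              (mem_product.1 ((mem_powersetCard.1 hY).1 hbY)).2)
          (fun _ _ a _ => (hrowc S a).trans hSc.le)
        rwa [card_product, hTc, card_univ, Fintype.card_fin, Fintype.card_fin] at h
      · refine le_trans ?_ (mul_le_mul_of_nonneg_right hterm hN0.le)
        rw [← mul_assoc]
        gcongr
        refine (card_filter_le _ _).trans ?_
        rw [card_powersetCard, card_univ, Fintype.card_fin]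
    · rw [card_powersetCard, card_univ, Fintype.card_fin, ← mul_assoc]
      gcongr
  obtain ⟨f, hf₁, hf₂⟩ : ∃ f : Ω, (∀ r ∈ Icc 1 (n + Q), f ∉ bad₁ r) ∧ f ∉ bad₂ := by
    by_contra! hcon
    have hsub : (univ : Finset Ω) ⊆ (Icc 1 (n + Q)).biUnion bad₁ ∪ bad₂ := by
      intro f _
      rw [mem_union, mem_biUnion]
      by_cases h : ∃ r ∈ Icc 1 (n + Q), f ∈ bad₁ r
      · exact Or.inl h
      · push Not at h
        exact Or.inr (hcon f h)
    have hcard : N ≤ ∑ r ∈ Icc 1 (n + Q), (#(bad₁ r) : ℝ) + #bad₂ := by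
      have := (card_le_card hsub).trans
        ((card_union_le _ _).trans (Nat.add_le_add_right card_biUnion_le _))
      rw [card_univ] at this
      rw [hN]
      exact_mod_cast this
    have hsum := sum_le_sum h₁
    rw [← sum_mul] at hsum
    have := mul_le_mul_of_nonneg_right (sum_quarter_pow_le (n + Q)) hN0.le
    linarith
  have hhalf : (2 * k + 1 + 1) / 2 = k + 1 := by omega
  refine ⟨⟨fun i u => f (i, u)⟩, fun R hR => ?_, fun S hS => ?_⟩
  · rw [hhalf]
    by_contra! hlt
    have hR0 : 1 ≤ #R := Nat.pos_of_ne_zero fun h => by simp [h] at hlt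
    exact hf₁ #R (mem_Icc.2 ⟨hR0, hR⟩) (mem_filter.2 ⟨mem_univ _, R,
      mem_powersetCard.2 ⟨subset_univ _, rfl⟩,
      NAGraph.exists_repetitions_of_ncard_Gamma_lt _ R hlt⟩)
  · rw [hhalf]
    by_contra! hlt
    obtain ⟨T, hT, hST, hY⟩ := NAGraph.exists_repetitions_of_lt_ncard _ S (Q + 1) hlt
    exact hf₂ (mem_filter.2 ⟨mem_univ _, S, mem_powersetCard.2 ⟨subset_univ _, hS⟩, T,
      mem_filter.2 ⟨hT, hST⟩, hY⟩)

end AdmissibleGraphs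

/-- For every odd integer `t ≥ 5`, for all sufficiently large `m` and all
integers `n` with `1 ≤ n ≤ m`, there exists a non-adaptive `(m,s,t)`-graph with
`s = ⌈60·m^(2/(t-1))·n^(1-2/(t-1))·log₂(2m/n)⌉` that is admissible for sets of
size at most `n`. -/
theorem na_admissible_graph_exists :
    ∀ t : ℕ, Odd t → 5 ≤ t → ∃ M : ℕ, ∀ m : ℕ, M ≤ m → ∀ n : ℕ, 1 ≤ n → n ≤ m →
      ∃ G : NAGraph m
        (⌈60 * (m : ℝ) ^ ((2 : ℝ) / ((t : ℝ) - 1)) *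
          (n : ℝ) ^ ((1 : ℝ) - 2 / ((t : ℝ) - 1)) *
          Real.logb 2 (2 * (m : ℝ) / (n : ℝ))⌉₊) t,
        G.Admissible n := by
  rintro t ⟨k, rfl⟩ ht
  refine ⟨0, fun m _ n hn hm => ?_⟩
  have hn' : (0 : ℝ) < n := by exact_mod_cast hn
  have hm' : (n : ℝ) ≤ m := by exact_mod_cast hm
  have hk0 : (k : ℝ) ≠ 0 := by
    have : k ≠ 0 := by omega
    exact_mod_cast this
  have hL : 0 < Real.logb 2 (2 * (m : ℝ) / n) :=
    Real.logb_pos (by norm_num) (by rw [lt_div_iff₀ hn']; linarith)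
  have hm0 : (0 : ℝ) < m := hn'.trans_le hm'
  refine NAGraph.exists_admissible (by omega) hn hm ?_ (Nat.ceil_pos.2 (by positivity))
  refine le_trans (le_of_eq ?_) (pow_le_pow_left₀ (by positivity) (Nat.le_ceil _) k)
  have he : (2 : ℝ) / (((2 * k + 1 : ℕ) : ℝ) - 1) = 1 / k := by
    push_cast
    field_simp
    ring
  have h1 : ((m : ℝ) ^ (1 / (k : ℝ))) ^ k = m := by
    rw [← Real.rpow_mul_natCast hm0.le, one_div_mul_cancel hk0, Real.rpow_one]
  have h2 : ((n : ℝ) ^ (1 - 1 / (k : ℝ))) ^ k = n ^ (k - 1) := by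
    rw [← Real.rpow_mul_natCast hn'.le, ← Real.rpow_natCast, Nat.cast_sub (by omega)]
    congr 1
    field_simp
    simp
  rw [he, mul_pow, mul_pow, mul_pow, h1, h2]
end

section
/- If a non-adaptive (m,s,t₁)-graph G₁ and an adaptive (m,s,t₂)-graph G₂ form an admissible pair for sets of size n, then the combined query scheme 𝒯_{G₁} ∧ 𝒯_{G₂} is satisfiable for every set S ⊆ [m] of size exactly n. -/
/-- Binary strings of length at most `t - 1` (the index `i : Fin t` is the
length). -/
def BStr (t : ℕ) : Type := Σ i : Fin t, (Fin i.val → Bool)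

/-- An adaptive `(m,s,t₂)`-graph: a bipartite graph with vertex sets `U = [m]`
and `BStr t₂ × Fin s` (the part `A_σ` for a binary string `σ` of length at most
`t₂ - 1` is `{σ} × Fin s`), where between each `u ∈ U` and each `A_σ` there is
exactly one edge, namely the one joining `u` to `(σ, nbr σ u)`. -/
structure AdGraph (m s t : ℕ) where
  nbr : BStr t → Fin m → Fin s

/-- The neighborhood `Γ_{G₂}(R)` of a set `R ⊆ [m]` in an adaptive graph. -/
def AdGraph.Gamma {m s t : ℕ} (G : AdGraph m s t) (R : Set (Fin m)) :
    Set (BStr t × Fin s) :=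
  {p | ∃ y ∈ R, G.nbr p.1 y = p.2}

/-- `leaves_{G₂}(R)`: the neighbors of `R` among the leaves of `G₂`, i.e. in the
parts `A_σ` with `|σ| = t - 1`. -/
def AdGraph.leaves {m s t : ℕ} (G : AdGraph m s t) (R : Set (Fin m)) :
    Set (BStr t × Fin s) :=
  {p | p.1.1.val = t - 1 ∧ ∃ y ∈ R, G.nbr p.1 y = p.2}

/-- The bit read by the systematic adaptive query scheme `𝒯_{G₂}` at its
`(k+1)`-st probe on query `x` with memory `L`: if the first `k` probes returned
the bits `σ`, the probe is made at the location indexed by the neighbor of `x`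
in `A_σ`. -/
def AdGraph.bit {m s t : ℕ} (G : AdGraph m s t) (L : BStr t × Fin s → Bool)
    (x : Fin m) : (k : ℕ) → k < t → Bool
  | k, hk =>
    let σ : BStr t := ⟨⟨k, hk⟩, fun j => G.bit L x j.val (Nat.lt_trans j.isLt hk)⟩
    L (σ, G.nbr σ x)
  termination_by k _ => k
  decreasing_by exact j.isLt

/-- The answer of the systematic adaptive query scheme `𝒯_{G₂}` on query `x`:
the last (i.e. `t`-th) bit read. -/
def AdGraph.answer {m s t : ℕ} (G : AdGraph m s t) (L : BStr t × Fin s → Bool)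
    (x : Fin m) : Bool :=
  if h : 0 < t then G.bit L x (t - 1) (by omega) else false

/-- `survivors G₁ S`: the elements `y ∉ S` all of whose neighbors in `G₁` are
neighbors of `S`. -/
def survivors {m s t₁ : ℕ} (G₁ : NAGraph m s t₁) (S : Finset (Fin m)) :
    Set (Fin m) :=
  {y | y ∉ S ∧ G₁.Gamma {y} ⊆ G₁.Gamma ↑S}

/-- `survivorsPlus G₁ G₂ S`: the survivors `y` such that
`leaves_{G₂}(S) ∩ leaves_{G₂}(y) ≠ ∅`. -/
def survivorsPlus {m s t₁ t₂ : ℕ} (G₁ : NAGraph m s t₁) (G₂ : AdGraph m s t₂)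
    (S : Finset (Fin m)) : Set (Fin m) :=
  {y | y ∈ survivors G₁ S ∧ (G₂.leaves ↑S ∩ G₂.leaves {y}).Nonempty}

/-- `(G₁, G₂)` is an admissible pair for sets of size `n` if, with
`β = 2^t₂ - t₂`: (P1) every `S ⊆ [m]` with `|S| = n` has
`|survivors(S)| ≤ 10·m·(n/s)^t₁`; and (P2) for every such `S` and every
`T ⊆ S ∪ survivors⁺(S)`, `|Γ_{G₂}(T)| ≥ β·|T|`. -/
def AdmissiblePair {m s t₁ t₂ : ℕ} (G₁ : NAGraph m s t₁) (G₂ : AdGraph m s t₂)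
    (n : ℕ) : Prop :=
  (∀ S : Finset (Fin m), S.card = n →
      ((survivors G₁ S).ncard : ℝ) ≤ 10 * (m : ℝ) * ((n : ℝ) / (s : ℝ)) ^ t₁) ∧
  (∀ S : Finset (Fin m), S.card = n → ∀ T : Finset (Fin m),
      (↑T : Set (Fin m)) ⊆ (↑S : Set (Fin m)) ∪ survivorsPlus G₁ G₂ S →
      (2 ^ t₂ - t₂) * T.card ≤ (G₂.Gamma ↑T).ncard)

/-- The combined scheme `𝒯_{G₁} ∧ 𝒯_{G₂}` is satisfiable for `S` if some
assignment to the two memories answers every membership query correctly, where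
the answer on query `x` is Yes iff all `t₁` bits read by `𝒯_{G₁}` are `1` and
the last bit read by `𝒯_{G₂}` is `1`. -/
def CombinedSatisfiable {m s t₁ t₂ : ℕ} (G₁ : NAGraph m s t₁)
    (G₂ : AdGraph m s t₂) (S : Finset (Fin m)) : Prop :=
  ∃ (L₁ : Fin t₁ × Fin s → Bool) (L₂ : BStr t₂ × Fin s → Bool),
    ∀ x : Fin m,
      (((∀ i : Fin t₁, L₁ (i, G₁.nbr i x) = true) ∧ G₂.answer L₂ x = true) ↔ x ∈ S)

open Finset in
/-- Hall's theorem with multiplicities: if every finite set `T` of indices has at least `b * #T`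
neighbors, then each index can be given `b` neighbors of its own. -/
theorem Finset.exists_injective_prod_fin_of_mul_card_le {ι α : Type*} [DecidableEq α]
    (N : ι → Finset α) (b : ℕ) (h : ∀ T : Finset ι, b * #T ≤ #(T.biUnion N)) :
    ∃ f : ι × Fin b → α, Function.Injective f ∧ ∀ p, f p ∈ N p.1 := by
  classical
  refine (Finset.all_card_le_biUnion_card_iff_exists_injective fun p : ι × Fin b => N p.1).1
    fun A => ?_
  calc #A ≤ #(A.image Prod.fst ×ˢ (univ : Finset (Fin b))) :=
        card_le_card fun p hp => by simpa using ⟨p.2, hp⟩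
    _ = b * #(A.image Prod.fst) := by simp [mul_comm]
    _ ≤ #((A.image Prod.fst).biUnion N) := h _
    _ = #(A.biUnion fun p => N p.1) := by rw [image_biUnion]

instance (t : ℕ) : Fintype (BStr t) :=
  inferInstanceAs (Fintype (Σ i : Fin t, (Fin i.val → Bool)))

theorem BStr.card (t : ℕ) : Fintype.card (BStr t) = 2 ^ t - 1 := by
  change Fintype.card (Σ i : Fin t, (Fin i.val → Bool)) = _
  simp [Fintype.card_sigma, Fin.sum_univ_eq_sum_range (fun i => 2 ^ i) t, Nat.geomSum_eq]

namespace AdGraph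

variable {m s t : ℕ} (G : AdGraph m s t)

/-- The string of bits returned by the first `k` probes on query `x`. -/
def node (L : BStr t × Fin s → Bool) (x : Fin m) (k : ℕ) (hk : k < t) : BStr t :=
  ⟨⟨k, hk⟩, fun j => G.bit L x j.val (j.isLt.trans hk)⟩

theorem bit_eq (L : BStr t × Fin s → Bool) (x : Fin m) (k : ℕ) (hk : k < t) :
    G.bit L x k hk = L (G.node L x k hk, G.nbr (G.node L x k hk) x) := by
  rw [bit]
  rfl

end AdGraph

/-- The elements of `B` that properly extend `σ`, continuing it with the bit `b`. -/
noncomputable def BStr.extensions {t : ℕ} (B : Finset (BStr t)) (σ : BStr t) (b : Bool) :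
    Finset (BStr t) := by
  classical
  exact B.filter fun τ => σ.1.val < τ.1.val ∧ ∀ j : Fin τ.1.val,
    (∀ h : j.val < σ.1.val, τ.2 j = σ.2 ⟨j, h⟩) ∧ (j.val = σ.1.val → τ.2 j = b)

open Finset in
/-- If the probes made outside a set `B` of fewer than `t` strings always continue in the direction
with fewer elements of `B`, then the last probe is made outside `B`. -/
theorem AdGraph.node_last_notMem {m s t : ℕ} (G : AdGraph m s t) (B : Finset (BStr t))
    (L : BStr t × Fin s → Bool) (x : Fin m) (ht : 0 < t) (hB : #B ≤ t - 1)
    (hL : ∀ σ ∉ B, σ.1.val + 1 < t →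
      L (σ, G.nbr σ x) = decide (#(σ.extensions B true) ≤ #(σ.extensions B false))) :
    G.node L x (t - 1) (by omega) ∉ B := by
  classical
  let R (k : ℕ) : Finset (BStr t) := B.filter fun τ => k ≤ τ.1.val ∧
    ∀ j : Fin τ.1.val, j.val < k → τ.2 j = G.bit L x j.val (j.isLt.trans τ.1.isLt)
  have hmem (k : ℕ) (hk : k < t) (h : G.node L x k hk ∈ B) : G.node L x k hk ∈ R k := by
    simp only [R, mem_filter]
    exact ⟨h, le_rfl, fun _ _ => rfl⟩
  have key : ∀ k, k < t → #(R k) ≤ t - 1 - k := by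
    intro k
    induction k with
    | zero => exact fun _ => (card_le_card (filter_subset _ _)).trans hB
    | succ k ih =>
      intro hk
      have hk' : k < t := by omega
      have ih := ih hk'
      set σ := G.node L x k hk' with hσ
      have hext (b : Bool) : σ.extensions B b ⊆ R k := by
        intro τ hτ
        simp only [BStr.extensions, R, mem_filter] at hτ ⊢
        exact ⟨hτ.1, hτ.2.1.le, fun j hj => (hτ.2.2 j).1 hj⟩
      have hnot (b : Bool) : σ ∉ σ.extensions B b := by
        simp [BStr.extensions]
      have hstep : R (k + 1) = σ.extensions B (G.bit L x k hk') := by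
        ext τ
        simp only [BStr.extensions, R, mem_filter]
        refine and_congr_right fun _ => and_congr Iff.rfl (forall_congr' fun j => ?_)
        constructor
        · intro h
          refine ⟨fun hj => h (Nat.lt_succ_of_lt hj), fun hj => ?_⟩
          rw [h (Nat.lt_succ_of_le hj.le)]
          congr 1
        · rintro ⟨h₁, h₂⟩ hj
          rcases Nat.lt_succ_iff_lt_or_eq.1 hj with hj | hj
          · exact h₁ hj
          · rw [h₂ hj]
            congr 1
            exact hj.symm
      by_cases hσB : σ ∈ B
      · have := card_le_card (insert_subset (hmem k hk' hσB) (hext (G.bit L x k hk')))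
        rw [card_insert_of_notMem (hnot _), ← hstep] at this
        omega
      · have hdisj : Disjoint (σ.extensions B true) (σ.extensions B false) := by
          rw [disjoint_left]
          intro τ h₁ h₂
          simp only [BStr.extensions, mem_filter] at h₁ h₂
          have e₁ := (h₁.2.2 ⟨_, h₁.2.1⟩).2 rfl
          have e₂ := (h₂.2.2 ⟨_, h₁.2.1⟩).2 rfl
          simp [e₁] at e₂
        have hsum := card_le_card (union_subset (hext true) (hext false))
        rw [card_union_of_disjoint hdisj] at hsum
        have hbit := hL σ hσB hk
        rw [← G.bit_eq L x k hk'] at hbit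
        rw [hstep, hbit]
        by_cases hc : #(σ.extensions B true) ≤ #(σ.extensions B false)
        · simp only [hc, decide_true]
          omega
        · simp only [hc, decide_false]
          omega
  intro hmemB
  have := card_pos.2 ⟨_, hmem _ _ hmemB⟩
  have := key (t - 1) (by omega)
  omega

open Finset in
/-- If every subset `T` of `X` has at least `(2 ^ t - t) * #T` neighbors, then the memory can be
chosen so that the systematic scheme accepts the elements of `X` that lie in `S`, rejects the other
elements of `X`, and rejects every query that has no leaf in common with `S`. -/
theorem AdGraph.exists_answer_eq {m s t : ℕ} (G : AdGraph m s t) (X : Set (Fin m))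
    (S : Finset (Fin m))
    (h : ∀ T : Finset (Fin m), (↑T : Set (Fin m)) ⊆ X →
      (2 ^ t - t) * #T ≤ (G.Gamma ↑T).ncard) :
    ∃ L : BStr t × Fin s → Bool, (∀ x ∈ X, G.answer L x = true ↔ x ∈ S) ∧
      ∀ x, ¬ (G.leaves ↑S ∩ G.leaves {x}).Nonempty → G.answer L x = false := by
  classical
  rcases Nat.eq_zero_or_pos t with rfl | ht
  · have hX : X = ∅ := by
      refine Set.eq_empty_of_forall_notMem fun x hx => ?_
      have := h {x} (by simpa using hx)
      have hΓ : G.Gamma ↑({x} : Finset (Fin m)) = ∅ :=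
        Set.eq_empty_of_forall_notMem fun p _ => p.1.1.elim0
      simp only [hΓ, Finset.card_singleton, Set.ncard_empty] at this
      omega
    exact ⟨fun _ => false, by simp [hX], by simp [AdGraph.answer]⟩
  obtain ⟨f, hf, hfN⟩ := Finset.exists_injective_prod_fin_of_mul_card_le
    (fun y : X => univ.image fun σ : BStr t => (σ, G.nbr σ y)) (2 ^ t - t) (by
      intro T
      have hT := h (T.map (Function.Embedding.subtype _)) (by
        intro x hx
        simp only [coe_map, Set.mem_image] at hx
        obtain ⟨y, -, rfl⟩ := hx
        exact y.2)
      rw [card_map] at hT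
      refine hT.trans_eq ?_
      rw [← Set.ncard_coe_finset]
      congr 1
      ext ⟨σ, v⟩
      simp [AdGraph.Gamma])
  replace hfN (y : X) (i : Fin (2 ^ t - t)) : f (y, i) = ((f (y, i)).1, G.nbr (f (y, i)).1 y) := by
    have := hfN (y, i)
    simp only [mem_image, mem_univ, true_and] at this
    obtain ⟨σ, hσ⟩ := this
    rw [← hσ]
  let own (y : X) : Finset (BStr t) := univ.image fun i => (f (y, i)).1
  have hown (y : X) : #(own y)ᶜ ≤ t - 1 := by
    have hinj : Function.Injective fun i => (f (y, i)).1 := fun i j hij => by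
      have hij : (f (y, i)).1 = (f (y, j)).1 := hij
      have : f (y, i) = f (y, j) := by rw [hfN y i, hfN y j, hij]
      exact (Prod.mk.inj (hf this)).2
    rw [card_compl, BStr.card, card_image_of_injective _ hinj, card_univ, Fintype.card_fin]
    have := t.lt_two_pow_self
    omega
  let value (y : X) (σ : BStr t) : Bool :=
    if σ.1.val + 1 < t then
      decide (#(σ.extensions (own y)ᶜ true) ≤ #(σ.extensions (own y)ᶜ false))
    else decide (y.1 ∈ S)
  let L (p : BStr t × Fin s) : Bool := decide (∃ y i, f (y, i) = p ∧ value y p.1 = true)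
  have hL (y : X) (σ : BStr t) (hσ : σ ∈ own y) : L (σ, G.nbr σ y) = value y σ := by
    obtain ⟨i, -, rfl⟩ := mem_image.1 hσ
    rw [← hfN y i, Bool.eq_iff_iff]
    simp only [L, decide_eq_true_eq]
    constructor
    · rintro ⟨z, j, hzj, hv⟩
      obtain rfl := (Prod.mk.inj (hf hzj)).1
      exact hv
    · exact fun hv => ⟨y, i, rfl, hv⟩
  have hans (x : Fin m) : G.answer L x = L (G.node L x (t - 1) (by omega),
      G.nbr (G.node L x (t - 1) (by omega)) x) := by
    rw [AdGraph.answer, dif_pos ht, AdGraph.bit_eq]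
  have hlast (x : Fin m) (y : X) : value y (G.node L x (t - 1) (by omega)) = decide (y.1 ∈ S) :=
    if_neg (by change ¬ (t - 1 + 1 < t); omega)
  refine ⟨L, fun x hx => ?_, fun x hx => ?_⟩
  · have hmem := G.node_last_notMem (own ⟨x, hx⟩)ᶜ L x ht (hown _) fun σ hσ hlt => by
      rw [hL ⟨x, hx⟩ σ (by simpa using hσ)]
      exact if_pos hlt
    rw [hans, hL ⟨x, hx⟩ _ (by simpa using hmem), hlast]
    simp
  · by_contra hne
    rw [Bool.not_eq_false, hans] at hne
    simp only [L, decide_eq_true_eq] at hne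
    obtain ⟨y, i, hyi, hv⟩ := hne
    rw [hlast, decide_eq_true_eq] at hv
    have hy := hfN y i
    rw [hyi] at hy
    exact hx ⟨_, ⟨rfl, y, hv, (congrArg Prod.snd hy).symm⟩, ⟨rfl, x, rfl, rfl⟩⟩

/-- If a non-adaptive `(m,s,t₁)`-graph `G₁` and an adaptive `(m,s,t₂)`-graph
`G₂` form an admissible pair for sets of size `n`, then the combined query
scheme `𝒯_{G₁} ∧ 𝒯_{G₂}` is satisfiable for every set `S ⊆ [m]` of size
exactly `n`. -/
theorem admissible_pair_implies_satisfiable {m s t₁ t₂ n : ℕ}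
    (G₁ : NAGraph m s t₁) (G₂ : AdGraph m s t₂)
    (h : AdmissiblePair G₁ G₂ n) :
    ∀ S : Finset (Fin m), S.card = n → CombinedSatisfiable G₁ G₂ S := by
  classical
  intro S hS
  obtain ⟨L₂, hX, hne⟩ := G₂.exists_answer_eq (↑S ∪ survivorsPlus G₁ G₂ S) S (h.2 S hS)
  refine ⟨fun p => decide (p ∈ G₁.Gamma ↑S), L₂, fun x => ?_⟩
  simp only [decide_eq_true_eq]
  constructor
  · rintro ⟨hx₁, hx₂⟩
    by_contra hxS
    have hsurv : x ∈ survivors G₁ S := by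
      refine ⟨hxS, ?_⟩
      rintro ⟨i, v⟩ ⟨y, hy, hv⟩
      obtain rfl : y = x := hy
      obtain rfl : G₁.nbr i y = v := hv
      exact hx₁ i
    by_cases hl : (G₂.leaves ↑S ∩ G₂.leaves {x}).Nonempty
    · exact hxS ((hX x (Or.inr ⟨hsurv, hl⟩)).1 hx₂)
    · simp [hne x hl] at hx₂
  · exact fun hxS => ⟨fun i => ⟨x, hxS, rfl⟩, (hX x (Or.inl hxS)).2 hxS⟩
end

section
/- Let t ≥ 3 be an odd integer and set t₁ = (t−3)/2 and t₂ = (t+3)/2. For every ε > 0, for all sufficiently large m, all odd t with 3 ≤ t ≤ (1/10)·log₂ log₂ m, and all integers n with 1 ≤ n ≤ m^{1−ε}, there exist a non-adaptive (m,s,t₁)-graph G₁ and an adaptive (m,s,t₂)-graph G₂ that form an admissible pair for sets of size n, with s = ⌈exp(e^{2t} − t) · m^{2/(t+1)} · n^{1 − 2/(t+1)} · log₂ m⌉. -/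
/-- The probability of `p` under the uniform distribution on a finite type. -/
noncomputable def uniformProb {Ω : Type*} [Fintype Ω] (p : Ω → Prop) : ℝ :=
  (Nat.card {ω // p ω} : ℝ) / Fintype.card Ω

section UniformProb

variable {Ω : Type*} [Fintype Ω]

theorem uniformProb_nonneg (p : Ω → Prop) : 0 ≤ uniformProb p := by
  unfold uniformProb; positivity

theorem uniformProb_mono {p q : Ω → Prop} (h : ∀ ω, p ω → q ω) :
    uniformProb p ≤ uniformProb q := by
  unfold uniformProb
  gcongr
  exact Nat.card_le_card_of_injective (fun x : {ω // p ω} => (⟨x.1, h _ x.2⟩ : {ω // q ω}))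
    fun x y hxy => Subtype.ext (by simpa using hxy)

theorem uniformProb_false {p : Ω → Prop} (h : ∀ ω, ¬ p ω) : uniformProb p = 0 := by
  unfold uniformProb
  have : IsEmpty {ω // p ω} := ⟨fun x => h _ x.2⟩
  simp

theorem uniformProb_exists_le {ι : Type*} (A : Finset ι) (p : ι → Ω → Prop) :
    uniformProb (fun ω => ∃ a ∈ A, p a ω) ≤ ∑ a ∈ A, uniformProb (p a) := by
  classical
  unfold uniformProb
  rw [← Finset.sum_div]
  gcongr
  simp only [Nat.card_eq_fintype_card, Fintype.card_subtype]
  have : (Finset.univ.filter fun ω => ∃ a ∈ A, p a ω)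
      = A.biUnion fun a => Finset.univ.filter (p a) := by
    ext; simp
  rw [this]
  exact_mod_cast Finset.card_biUnion_le

theorem uniformProb_exists_le_card_mul {ι : Type*} (A : Finset ι) (p : ι → Ω → Prop) (c : ℝ)
    (h : ∀ a ∈ A, uniformProb (p a) ≤ c) :
    uniformProb (fun ω => ∃ a ∈ A, p a ω) ≤ A.card * c :=
  (uniformProb_exists_le A p).trans ((Finset.sum_le_card_nsmul _ _ _ h).trans_eq (by simp))

theorem uniformProb_or_le (p q : Ω → Prop) :
    uniformProb (fun ω => p ω ∨ q ω) ≤ uniformProb p + uniformProb q := by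
  classical
  unfold uniformProb
  rw [← add_div]
  gcongr
  simp only [Nat.card_eq_fintype_card, Fintype.card_subtype, Finset.filter_or]
  exact_mod_cast Finset.card_union_le _ _

theorem exists_not_of_uniformProb_lt_one [Nonempty Ω] {p : Ω → Prop}
    (h : uniformProb p < 1) : ∃ ω, ¬ p ω := by
  by_contra! hp
  have : Nat.card {ω // p ω} = Fintype.card Ω := by
    classical
    simp [Nat.card_eq_fintype_card, Fintype.card_subtype, hp]
  unfold uniformProb at h
  rw [this, div_self (by positivity)] at h
  exact lt_irrefl _ h

end UniformProb

/-- If on the coordinates `F` a random function is confined to sets of size at most `q e` that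
depend only on the coordinates outside `F`, the probability is at most the product of the
densities. -/
theorem uniformProb_forall_mem_le {E V : Type*} [Fintype E] [DecidableEq E] [Fintype V]
    [Nonempty V] (F : Finset E) (K : (E → V) → E → Finset V) (q : E → ℕ)
    (hK : ∀ f g, (∀ e ∉ F, f e = g e) → ∀ e ∈ F, K f e = K g e)
    (hq : ∀ f, ∀ e ∈ F, (K f e).card ≤ q e) :
    uniformProb (fun f : E → V => ∀ e ∈ F, f e ∈ K f e) ≤
      ∏ e ∈ F, ((q e : ℝ) / Fintype.card V) := by
  classical
  have key : (Finset.univ.filter fun f : E → V => ∀ e ∈ F, f e ∈ K f e).card ≤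
      (∏ e ∈ F, q e) * (Finset.univ : Finset ({e // e ∉ F} → V)).card := by
    refine Finset.card_le_mul_card_image_of_maps_to
      (f := fun f (e : {e // e ∉ F}) => f e.1) (fun _ _ => Finset.mem_univ _) _ ?_
    intro b _
    rcases Finset.eq_empty_or_nonempty ((Finset.univ.filter fun f : E → V =>
      ∀ e ∈ F, f e ∈ K f e).filter fun f => (fun (e : {e // e ∉ F}) => f e.1) = b) with h0 | ⟨g, hg⟩
    · rw [h0]; simp
    · simp only [Finset.mem_filter, Finset.mem_univ, true_and] at hg
      have agree : ∀ f : E → V, (fun (e : {e // e ∉ F}) => f e.1) = b → ∀ e ∉ F, f e = g e := by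
        intro f hf e he
        have := congrFun (hf.trans hg.2.symm) ⟨e, he⟩
        exact this
      calc _ ≤ (Fintype.piFinset fun e : {e // e ∈ F} => K g e.1).card := by
            refine Finset.card_le_card_of_injOn (fun f (e : {e // e ∈ F}) => f e.1) ?_ ?_
            · intro f hf
              simp only [Finset.coe_filter, Finset.mem_filter, Finset.mem_univ, true_and] at hf
              simp only [Finset.mem_coe, Fintype.mem_piFinset]
              intro e
              rw [← hK f g (agree f hf.2) e.1 e.2]
              exact hf.1 e.1 e.2
            · intro f hf f' hf' hff
              simp only [Finset.coe_filter, Finset.mem_filter, Finset.mem_univ, true_and] at hf hf'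
              ext e
              by_cases he : e ∈ F
              · exact congrFun hff ⟨e, he⟩
              · rw [agree f hf.2 e he, agree f' hf'.2 e he]
        _ = ∏ e : {e // e ∈ F}, (K g e.1).card := Fintype.card_piFinset _
        _ ≤ ∏ e : {e // e ∈ F}, q e.1 := Finset.prod_le_prod' fun e _ => hq g e.1 e.2
        _ = ∏ e ∈ F, q e := Finset.prod_coe_sort F q
  have hcard : Fintype.card E = F.card + Fintype.card {e // e ∉ F} := by
    have := Fintype.card_subtype_compl (fun e => e ∈ F)
    have h2 := Fintype.card_subtype_le (fun e => e ∈ F)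
    simp only [Fintype.card_coe] at this h2
    omega
  have hV : (0 : ℝ) < Fintype.card V := by exact_mod_cast Fintype.card_pos
  unfold uniformProb
  rw [Nat.card_eq_fintype_card, Fintype.card_subtype, Finset.prod_div_distrib, Finset.prod_const,
    Fintype.card_fun, hcard, pow_add, div_le_div_iff₀ (by positivity) (by positivity)]
  rw [Finset.card_univ, Fintype.card_fun] at key
  have key' : ((Finset.univ.filter fun f : E → V => ∀ e ∈ F, f e ∈ K f e).card : ℝ) ≤
      (∏ e ∈ F, (q e : ℝ)) * (Fintype.card V : ℝ) ^ Fintype.card {e // e ∉ F} := by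
    exact_mod_cast key
  push_cast
  calc _ ≤ ((∏ e ∈ F, (q e : ℝ)) * (Fintype.card V : ℝ) ^ Fintype.card {e // e ∉ F}) *
        (Fintype.card V : ℝ) ^ F.card := by gcongr
    _ = _ := by ring

/-- The probability that every edge of `L` hits a neighbor of `S` while every edge of `F`
collides with another edge of `T`. -/
theorem uniformProb_collide_le {I α V : Type*} [Fintype I] [DecidableEq I] [Fintype α]
    [DecidableEq α] [Fintype V] [Nonempty V] (S T : Finset α) (hST : Disjoint S T)
    (L F : Finset (I × α)) (hL : L ⊆ Finset.univ ×ˢ T) (hF : F ⊆ Finset.univ ×ˢ T)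
    (hLF : Disjoint L F) :
    uniformProb (fun f : I × α → V => (∀ e ∈ L, ∃ y ∈ S, f (e.1, y) = f e) ∧
        ∀ e ∈ F, ∃ e' ∈ (Finset.univ ×ˢ T) \ (L ∪ F), e'.1 = e.1 ∧ f e' = f e) ≤
      ((S.card : ℝ) / Fintype.card V) ^ L.card * ((T.card : ℝ) / Fintype.card V) ^ F.card := by
  classical
  let K : (I × α → V) → I × α → Finset V := fun f e =>
    if e ∈ L then S.image fun y => f (e.1, y)
    else (T.filter fun y => (e.1, y) ∉ L ∪ F).image fun y => f (e.1, y)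
  let q : I × α → ℕ := fun e => if e ∈ L then S.card else T.card
  refine (uniformProb_mono (q := fun f => ∀ e ∈ L ∪ F, f e ∈ K f e) ?_).trans
    ((uniformProb_forall_mem_le (L ∪ F) K q ?_ ?_).trans_eq ?_)
  · rintro f ⟨h1, h2⟩ e he
    by_cases heL : e ∈ L
    · obtain ⟨y, hy, hf⟩ := h1 e heL
      simp only [K, heL, if_true, Finset.mem_image]
      exact ⟨y, hy, hf⟩
    · obtain ⟨⟨i, y⟩, he', hi, hf⟩ := h2 e ((Finset.mem_union.1 he).resolve_left heL)
      simp only [Finset.mem_sdiff, Finset.mem_product, Finset.mem_univ, true_and] at he' hi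
      subst hi
      simp only [K, heL, if_false, Finset.mem_image, Finset.mem_filter]
      exact ⟨y, he', hf⟩
  · intro f g hfg e he
    by_cases heL : e ∈ L
    · simp only [K, heL, if_true]
      refine Finset.image_congr fun y hy => hfg _ fun hmem => ?_
      have : y ∈ T := by
        rcases Finset.mem_union.1 hmem with h | h
        · exact (Finset.mem_product.1 (hL h)).2
        · exact (Finset.mem_product.1 (hF h)).2
      exact Finset.disjoint_left.1 hST hy this
    · simp only [K, heL, if_false]
      exact Finset.image_congr fun y hy => hfg _ (Finset.mem_filter.1 hy).2
  · intro f e he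
    by_cases heL : e ∈ L
    · simp only [K, q, heL, if_true]
      exact Finset.card_image_le
    · simp only [K, q, heL, if_false]
      exact Finset.card_image_le.trans (Finset.card_filter_le _ _)
  · rw [Finset.prod_union hLF]
    congr 1
    · rw [← Finset.prod_const]
      exact Finset.prod_congr rfl fun e he => by simp [q, he]
    · rw [← Finset.prod_const]
      exact Finset.prod_congr rfl fun e he => by
        simp [q, Finset.disjoint_right.1 hLF he]

/-- A function with a small image on `X` has many elements whose value is repeated. -/
theorem Finset.exists_collisions {E W : Type*} [DecidableEq E] [DecidableEq W] (X : Finset E)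
    (g : E → W) (D : ℕ) (h : (X.image g).card + D ≤ X.card) :
    ∃ F ⊆ X, F.card = D ∧ ∀ e ∈ F, ∃ e' ∈ X \ F, g e' = g e := by
  obtain ⟨R, hR, hRg, hcard⟩ :
      ∃ R ⊆ X, R.image g = X.image g ∧ R.card = (X.image g).card := by
    classical
    have hsurj : Set.SurjOn g (X : Set E) (X.image g : Set W) := by
      intro w hw
      simpa using hw
    obtain ⟨R, hR, hb⟩ := hsurj.exists_bijOn_subset
    have hRX : ((X.filter (· ∈ R) : Finset E) : Set E) = R := by
      ext e
      simpa using fun he => hR he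
    have himg : (X.filter (· ∈ R)).image g = X.image g := by
      rw [← Finset.coe_inj, Finset.coe_image, hRX, hb.image_eq]
    refine ⟨X.filter (· ∈ R), Finset.filter_subset _ _, himg, ?_⟩
    rw [← himg, Finset.card_image_of_injOn (by rw [hRX]; exact hb.injOn)]
  obtain ⟨F, hF, hFc⟩ := Finset.exists_subset_card_eq (s := X \ R) (n := D) (by
    rw [Finset.card_sdiff_of_subset hR]; omega)
  refine ⟨F, hF.trans Finset.sdiff_subset, hFc, fun e he => ?_⟩
  have heX := Finset.sdiff_subset (hF he)
  have : g e ∈ R.image g := hRg ▸ Finset.mem_image_of_mem g heX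
  obtain ⟨e', he', hge⟩ := Finset.mem_image.1 this
  exact ⟨e', Finset.mem_sdiff.2 ⟨hR he', fun h' => (Finset.mem_sdiff.1 (hF h')).2 he'⟩, hge⟩

/-- `a` of the edges of `T` hit neighbors of `S`, and the other edges of `T` have at least `D`
collisions among themselves. -/
def Deficient {I α V : Type*} [Fintype I] [DecidableEq I] [DecidableEq α] [DecidableEq V]
    (S T : Finset α) (a D : ℕ) (f : I × α → V) : Prop :=
  ∃ L ∈ (Finset.univ ×ˢ T).powersetCard a, (∀ e ∈ L, ∃ y ∈ S, f (e.1, y) = f e) ∧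
    (((Finset.univ ×ˢ T) \ L).image fun e => (e.1, f e)).card + D ≤
      ((Finset.univ ×ˢ T) \ L).card

section Random

variable {I α V : Type*} [Fintype I] [DecidableEq I] [Fintype α] [DecidableEq α] [Fintype V]
  [DecidableEq V] [Nonempty V]

theorem uniformProb_deficient_le (S T : Finset α) (hST : Disjoint S T) (a D : ℕ) :
    uniformProb (Deficient S T a D : (I × α → V) → Prop) ≤
      4 ^ (Fintype.card I * T.card) * (((S.card : ℝ) / Fintype.card V) ^ a *
        ((T.card : ℝ) / Fintype.card V) ^ D) := by
  set c : ℝ := ((S.card : ℝ) / Fintype.card V) ^ a * ((T.card : ℝ) / Fintype.card V) ^ D with hc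
  have hc0 : 0 ≤ c := by positivity
  have hcard : ∀ X : Finset (I × α), X ⊆ Finset.univ ×ˢ T → ∀ b,
      ((X.powersetCard b).card : ℝ) ≤ 2 ^ (Fintype.card I * T.card) := by
    intro X hX b
    have h1 : (X.powersetCard b).card ≤ 2 ^ X.card := by
      rw [Finset.card_powersetCard]; exact Nat.choose_le_two_pow _ _
    have h2 : X.card ≤ Fintype.card I * T.card := by
      simpa using Finset.card_le_card hX
    exact_mod_cast h1.trans (Nat.pow_le_pow_right (by norm_num) h2)
  have inner : ∀ L ∈ ((Finset.univ : Finset I) ×ˢ T).powersetCard a,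
      uniformProb (fun f : I × α → V => (∀ e ∈ L, ∃ y ∈ S, f (e.1, y) = f e) ∧
        (((Finset.univ ×ˢ T) \ L).image fun e => (e.1, f e)).card + D ≤
          ((Finset.univ ×ˢ T) \ L).card) ≤ 2 ^ (Fintype.card I * T.card) * c := by
    intro L hL
    obtain ⟨hL, hLa⟩ := Finset.mem_powersetCard.1 hL
    refine (uniformProb_mono (q := fun f => ∃ F ∈ ((Finset.univ ×ˢ T) \ L).powersetCard D,
      (∀ e ∈ L, ∃ y ∈ S, f (e.1, y) = f e) ∧
        ∀ e ∈ F, ∃ e' ∈ (Finset.univ ×ˢ T) \ (L ∪ F), e'.1 = e.1 ∧ f e' = f e) ?_).trans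
      ((uniformProb_exists_le_card_mul _ _ c ?_).trans ?_)
    · rintro f ⟨h1, h2⟩
      obtain ⟨F, hF, hFD, h⟩ := Finset.exists_collisions _ _ D h2
      refine ⟨F, Finset.mem_powersetCard.2 ⟨hF, hFD⟩, h1, fun e he => ?_⟩
      obtain ⟨e', he', heq⟩ := h e he
      refine ⟨e', ?_, by simpa using heq⟩
      rwa [← Finset.sup_eq_union, ← sdiff_sdiff]
    · intro F hF
      obtain ⟨hF, hFD⟩ := Finset.mem_powersetCard.1 hF
      rw [hc, ← hLa, ← hFD]
      exact uniformProb_collide_le S T hST L F hL (hF.trans Finset.sdiff_subset)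
        (Finset.disjoint_left.2 fun e he he' => (Finset.mem_sdiff.1 (hF he')).2 he)
    · gcongr
      exact hcard _ Finset.sdiff_subset D
  refine (uniformProb_exists_le_card_mul _ _ _ inner).trans ?_
  calc _ ≤ (2 : ℝ) ^ (Fintype.card I * T.card) * (2 ^ (Fintype.card I * T.card) * c) := by
        gcongr
        exact hcard _ subset_rfl a
    _ = 4 ^ (Fintype.card I * T.card) * c := by
        rw [← mul_assoc, ← mul_pow]; norm_num

theorem sum_Icc_one_quarter_pow_le (m : ℕ) : ∑ j ∈ Finset.Icc 1 m, (1 / 4 : ℝ) ^ j ≤ 1 / 3 := by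
  have : ∑ j ∈ Finset.Icc 1 m, (1 / 4 : ℝ) ^ j = 1 / 3 * (1 - (1 / 4) ^ m) := by
    induction m with
    | zero => simp
    | succ m ih => rw [Finset.sum_Icc_succ_top (by omega), ih]; ring
  rw [this]
  have : (0 : ℝ) ≤ (1 / 4) ^ m := by positivity
  linarith

/-- Union bound: some graph has no small deficient set and no large deficient set of candidates. -/
theorem exists_forall_not_deficient (n W r : ℕ) (X : ℝ) (D : ℕ → ℕ)
    (A : Finset α → Finset α) (hAS : ∀ S, Disjoint S (A S))
    (hA : ∀ S, S.card = n → (A S).card ≤ W)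
    (hsmall : ∀ j : ℕ, 1 ≤ j → (j : ℝ) ≤ 2 * X →
      ((Fintype.card α).choose j : ℝ) * (4 ^ (Fintype.card I * j) *
        ((j : ℝ) / Fintype.card V) ^ (r * j)) ≤ (1 / 4) ^ j)
    (hlarge : ∀ j : ℕ, 1 ≤ j → X ≤ (j : ℝ) → j ≤ Fintype.card V →
      ((Fintype.card α).choose n : ℝ) * ((W.choose j : ℝ) * (4 ^ (Fintype.card I * j) *
        (((n : ℝ) / Fintype.card V) ^ j * ((j : ℝ) / Fintype.card V) ^ D j))) ≤ (1 / 4) ^ j) :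
    ∃ f : I × α → V,
      (∀ T : Finset α, T.Nonempty → (T.card : ℝ) ≤ 2 * X → ¬ Deficient ∅ T 0 (r * T.card) f) ∧
      ∀ S : Finset α, S.card = n → ∀ T ⊆ A S, T.Nonempty → X ≤ (T.card : ℝ) →
        T.card ≤ Fintype.card V → ¬ Deficient S T T.card (D T.card) f := by
  let p : (I × α → V) → Prop := fun f => ∃ j ∈ Finset.Icc 1 (Fintype.card α), (j : ℝ) ≤ 2 * X ∧
    ∃ T ∈ (Finset.univ : Finset α).powersetCard j, Deficient ∅ T 0 (r * j) f
  let q : (I × α → V) → Prop := fun f => ∃ j ∈ Finset.Icc 1 (Fintype.card α),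
    (X ≤ (j : ℝ) ∧ j ≤ Fintype.card V) ∧ ∃ S ∈ (Finset.univ : Finset α).powersetCard n,
      ∃ T ∈ (A S).powersetCard j, Deficient S T j (D j) f
  have hp : uniformProb p ≤ 1 / 3 := by
    refine (uniformProb_exists_le _ _).trans
      ((Finset.sum_le_sum fun j hj => ?_).trans (sum_Icc_one_quarter_pow_le (Fintype.card α)))
    by_cases hX : (j : ℝ) ≤ 2 * X
    · simp only [hX, true_and]
      refine (uniformProb_exists_le_card_mul _ _ (4 ^ (Fintype.card I * j) *
        ((j : ℝ) / Fintype.card V) ^ (r * j)) fun T hT => ?_).trans ?_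
      · have := uniformProb_deficient_le (I := I) (V := V) ∅ T (by simp) 0 (r * j)
        rw [(Finset.mem_powersetCard.1 hT).2] at this
        simpa using this
      · rw [Finset.card_powersetCard, Finset.card_univ]
        exact hsmall j (Finset.mem_Icc.1 hj).1 hX
    · rw [uniformProb_false fun _ h => hX h.1]
      positivity
  have hq : uniformProb q ≤ 1 / 3 := by
    refine (uniformProb_exists_le _ _).trans
      ((Finset.sum_le_sum fun j hj => ?_).trans (sum_Icc_one_quarter_pow_le (Fintype.card α)))
    by_cases hX : X ≤ (j : ℝ) ∧ j ≤ Fintype.card V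
    · simp only [hX, true_and, and_self]
      refine (uniformProb_exists_le_card_mul _ _ ((W.choose j : ℝ) * (4 ^ (Fintype.card I * j) *
        (((n : ℝ) / Fintype.card V) ^ j * ((j : ℝ) / Fintype.card V) ^ D j)))
        fun S hS => ?_).trans ?_
      · have hSn := (Finset.mem_powersetCard.1 hS).2
        refine (uniformProb_exists_le_card_mul _ _ (4 ^ (Fintype.card I * j) *
          (((n : ℝ) / Fintype.card V) ^ j * ((j : ℝ) / Fintype.card V) ^ D j))
          fun T hT => ?_).trans ?_
        · obtain ⟨hTA, hTj⟩ := Finset.mem_powersetCard.1 hT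
          have := uniformProb_deficient_le (I := I) (V := V) S T
            (Finset.disjoint_of_subset_right hTA (hAS S)) j (D j)
          rwa [hTj, hSn] at this
        · rw [Finset.card_powersetCard]
          gcongr
          exact hA S hSn
      · rw [Finset.card_powersetCard, Finset.card_univ]
        exact hlarge j (Finset.mem_Icc.1 hj).1 hX.1 hX.2
    · rw [uniformProb_false fun _ h => hX h.1]
      positivity
  obtain ⟨f, hf⟩ := exists_not_of_uniformProb_lt_one (p := fun f => p f ∨ q f)
    ((uniformProb_or_le p q).trans_lt (by linarith))
  have hcard : ∀ T : Finset α, T.Nonempty → T.card ∈ Finset.Icc 1 (Fintype.card α) := fun T hT =>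
    Finset.mem_Icc.2 ⟨hT.card_pos, Finset.card_le_univ T⟩
  refine ⟨f, fun T hT hX h => hf (Or.inl ⟨T.card, hcard T hT, hX, T, ?_, h⟩),
    fun S hS T hTA hT hX hV h => hf (Or.inr ⟨T.card, hcard T hT, ⟨hX, hV⟩, S, ?_, T, ?_, h⟩)⟩ <;>
  simp [*]

end Random

/-- The deterministic consequence of having no deficient sets: sets of vertices in `S` or
candidates that share a neighbor with `S` expand. -/
theorem expansion_of_forall_not_deficient {I α V : Type*} [Fintype I] [DecidableEq I]
    [DecidableEq α] [DecidableEq V] (n r s : ℕ) (X : ℝ) (f : I × α → V) (S A : Finset α)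
    (hr : 2 ≤ r) (hrI : r ≤ Fintype.card I) (hSn : S.card = n) (hn : 1 ≤ n)
    (hX : ((Fintype.card I : ℝ) + 1) * n ≤ X) (hXs : X ≤ s)
    (hsmall : ∀ T : Finset α, T.Nonempty → (T.card : ℝ) ≤ 2 * X →
      ¬ Deficient ∅ T 0 (r * T.card) f)
    (hlarge : ∀ T ⊆ A, T.Nonempty → X ≤ (T.card : ℝ) → T.card ≤ s →
      ¬ Deficient S T T.card (if T.card < s then T.card - Fintype.card I * n else 0) f)
    (T : Finset α)
    (hT : ∀ y ∈ T, y ∈ S ∨ y ∈ A ∧ ∃ i, ∃ y' ∈ S, f (i, y') = f (i, y)) :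
    (Fintype.card I - r) * T.card ≤ ((Finset.univ ×ˢ T).image fun e => (e.1, f e)).card := by
  by_contra! hlt
  have hn' : (1 : ℝ) ≤ n := by exact_mod_cast hn
  have hI0 : (0 : ℝ) ≤ Fintype.card I := by positivity
  have hX0 : (1 : ℝ) ≤ X := by nlinarith
  have hnX : (n : ℝ) ≤ X := by nlinarith
  obtain ⟨M, hM⟩ := Nat.exists_eq_add_of_le hrI
  have hMI : Fintype.card I - r = M := by omega
  rw [hMI] at hlt
  have hTne : T.Nonempty := by
    rw [Finset.nonempty_iff_ne_empty]
    rintro rfl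
    simp at hlt
  have hTcard : T.card ≤ (T \ S).card + n := by
    rw [← hSn]
    exact Finset.card_le_card_sdiff_add_card
  have hedge : ∀ T' ⊆ T \ S, ∃ L ∈ (Finset.univ ×ˢ T').powersetCard T'.card,
      ∀ e ∈ L, ∃ y ∈ S, f (e.1, y) = f e := by
    intro T' hT'
    have : ∀ y : T', ∃ i, ∃ y' ∈ S, f (i, y') = f (i, y) := by
      rintro ⟨y, hy⟩
      have := Finset.mem_sdiff.1 (hT' hy)
      exact ((hT y this.1).resolve_left this.2).2
    choose i hi using this
    refine ⟨T'.attach.image fun y => (i y, y.1), ?_, ?_⟩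
    · rw [Finset.mem_powersetCard]
      constructor
      · intro e he
        obtain ⟨y, -, rfl⟩ := Finset.mem_image.1 he
        simp
      · rw [Finset.card_image_of_injective _ fun a b hab => Subtype.ext (Prod.ext_iff.1 hab).2,
          Finset.card_attach]
    · intro e he
      obtain ⟨y, -, rfl⟩ := Finset.mem_image.1 he
      exact hi y
  have hsub : T \ S ⊆ A := by
    intro y hy
    have := Finset.mem_sdiff.1 hy
    exact ((hT y this.1).resolve_left this.2).1
  have hne : ∀ T' : Finset α, X ≤ T'.card → T'.Nonempty := by
    intro T' h
    rw [← Finset.card_pos]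
    exact_mod_cast (by linarith : (0 : ℝ) < T'.card)
  rcases lt_or_ge ((T \ S).card : ℝ) X with hlo | hhi
  · refine hsmall T hTne ?_ ⟨∅, by simp, by simp, ?_⟩
    · have : (T.card : ℝ) ≤ (T \ S).card + n := by exact_mod_cast hTcard
      linarith
    · rw [Finset.sdiff_empty, Finset.card_product, Finset.card_univ, hM, add_mul]
      omega
  · rcases lt_or_ge (T \ S).card s with hs | hs
    · obtain ⟨L, hL, hLS⟩ := hedge (T \ S) subset_rfl
      refine hlarge _ hsub (hne _ hhi) hhi hs.le ⟨L, hL, hLS, ?_⟩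
      rw [if_pos hs]
      obtain ⟨hLsub, hLc⟩ := Finset.mem_powersetCard.1 hL
      rw [Finset.card_sdiff_of_subset hLsub, hLc, Finset.card_product, Finset.card_univ]
      have h1 : (((Finset.univ ×ˢ (T \ S)) \ L).image fun e => (e.1, f e)).card ≤
          ((Finset.univ ×ˢ T).image fun e => (e.1, f e)).card :=
        Finset.card_le_card (Finset.image_subset_image (Finset.sdiff_subset.trans
          (Finset.product_subset_product subset_rfl Finset.sdiff_subset)))
      have h2 : Fintype.card I * n ≤ (T \ S).card := by
        have : ((Fintype.card I : ℝ)) * n ≤ (T \ S).card := by nlinarith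
        exact_mod_cast this
      have h3 : M * T.card ≤ M * ((T \ S).card + n) := Nat.mul_le_mul_left _ hTcard
      rw [hM] at h2 ⊢
      generalize (T \ S).card = j at *
      have h4 : 2 * j ≤ r * j := Nat.mul_le_mul_right _ hr
      have h5 : (M + r) * j = M * j + r * j := by ring
      have h6 : (M + r) * n = M * n + r * n := by ring
      have h7 : M * (j + n) = M * j + M * n := by ring
      rw [add_comm r M] at h2 ⊢
      omega
    · obtain ⟨T', hT', hT'c⟩ := Finset.exists_subset_card_eq hs
      obtain ⟨L, hL, hLS⟩ := hedge T' hT'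
      refine hlarge T' (hT'.trans hsub) (hne _ (hT'c ▸ hXs)) (hT'c ▸ hXs) hT'c.le
        ⟨L, hL, hLS, ?_⟩
      rw [if_neg (by omega), add_zero]
      exact Finset.card_image_le

theorem Nat.choose_le_three_mul_div_pow (W j : ℕ) (hj : 1 ≤ j) :
    (W.choose j : ℝ) ≤ (3 * W / j) ^ j := by
  have hj0 : (0 : ℝ) < j := by exact_mod_cast hj
  have hf : (0 : ℝ) < j.factorial := by exact_mod_cast j.factorial_pos
  have h1 : (W.choose j : ℝ) ≤ (W : ℝ) ^ j / j.factorial := Nat.choose_le_pow_div j W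
  have h2 : (j : ℝ) ^ j / j.factorial ≤ 3 ^ j := by
    refine (Real.pow_div_factorial_le_exp _ hj0.le j).trans ?_
    rw [← mul_one (j : ℝ), Real.exp_nat_mul]
    gcongr
    exact Real.exp_one_lt_three.le
  refine h1.trans ?_
  rw [div_pow, mul_pow, div_le_div_iff₀ hf (by positivity)]
  rw [div_le_iff₀ hf] at h2
  calc (W : ℝ) ^ j * j ^ j ≤ W ^ j * (3 ^ j * j.factorial) := by gcongr
    _ = _ := by ring

/-- A random non-adaptive graph has few survivors for every set of size `n`. -/
theorem exists_survivors_ncard_le (m s n k : ℕ) (hn : 1 ≤ n) (hm : 1 ≤ m) (hs : 0 < s)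
    (hw : (m : ℝ) ^ n ≤ 2 ^ (⌊10 * (m : ℝ) * ((n : ℝ) / s) ^ k⌋₊ + 1)) :
    ∃ G : NAGraph m s k, ∀ S : Finset (Fin m), S.card = n →
      ((survivors G S).ncard : ℝ) ≤ 10 * (m : ℝ) * ((n : ℝ) / s) ^ k := by
  have : Nonempty (Fin s) := ⟨⟨0, hs⟩⟩
  set μ : ℝ := (m : ℝ) * ((n : ℝ) / s) ^ k with hμ
  have hμ0 : 0 < μ := by
    have : (0 : ℝ) < n := by exact_mod_cast hn
    have : (0 : ℝ) < m := by exact_mod_cast hm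
    have : (0 : ℝ) < s := by exact_mod_cast hs
    positivity
  rw [mul_assoc, ← hμ] at hw ⊢
  set w := ⌊10 * μ⌋₊ + 1 with hwdef
  have hwμ : 10 * μ < w := by rw [hwdef]; exact_mod_cast Nat.lt_floor_add_one _
  have hw0 : (0 : ℝ) < w := by linarith
  obtain ⟨f, hf⟩ := exists_not_of_uniformProb_lt_one
    (p := fun f : Fin k × Fin m → Fin s => ∃ S ∈ (Finset.univ : Finset (Fin m)).powersetCard n,
      ∃ Y ∈ (Finset.univ : Finset (Fin m)).powersetCard w,
        Disjoint S Y ∧ ∀ i, ∀ y ∈ Y, ∃ y' ∈ S, f (i, y') = f (i, y)) (by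
    refine (uniformProb_exists_le_card_mul _ _ (((m.choose w : ℕ) : ℝ) * ((n : ℝ) / s) ^ (k * w))
      fun S hS => (uniformProb_exists_le_card_mul _ _ (((n : ℝ) / s) ^ (k * w))
      fun Y hY => ?_).trans ?_).trans_lt ?_
    · by_cases hSY : Disjoint S Y
      · have := uniformProb_collide_le (I := Fin k) (V := Fin s) S Y hSY (Finset.univ ×ˢ Y) ∅
          subset_rfl (by simp) (by simp)
        rw [Finset.card_product, (Finset.mem_powersetCard.1 hY).2,
          (Finset.mem_powersetCard.1 hS).2] at this
        simp only [Finset.card_univ, Fintype.card_fin, Finset.card_empty, pow_zero,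
          mul_one] at this
        refine (uniformProb_mono ?_).trans this
        rintro f ⟨-, h⟩
        refine ⟨?_, by simp⟩
        rintro ⟨i, y⟩ he
        exact h i y (Finset.mem_product.1 he).2
      · rw [uniformProb_false fun _ h => hSY h.1]
        positivity
    · simp
    · rw [Finset.card_powersetCard, Finset.card_univ, Fintype.card_fin]
      have h1 : ((m.choose n : ℕ) : ℝ) ≤ 2 ^ w := by
        refine le_trans ?_ hw
        exact_mod_cast Nat.choose_le_pow m n
      have h2 : ((m.choose w : ℕ) : ℝ) * ((n : ℝ) / s) ^ (k * w) ≤ (3 / 10) ^ w := by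
        calc _ ≤ (3 * (m : ℝ) / w) ^ w * ((n : ℝ) / s) ^ (k * w) := by
              gcongr
              exact Nat.choose_le_three_mul_div_pow m w (by omega)
          _ = (3 * μ / w) ^ w := by
              rw [pow_mul, ← mul_pow, hμ]; congr 1; ring
          _ ≤ (3 / 10) ^ w := by
              gcongr ?_ ^ w
              rw [div_le_iff₀ hw0]
              linarith
      calc _ ≤ (2 : ℝ) ^ w * (3 / 10) ^ w := by gcongr
        _ = (3 / 5) ^ w := by rw [← mul_pow]; norm_num
        _ < 1 := pow_lt_one₀ (by norm_num) (by norm_num) (by omega))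
  refine ⟨⟨fun i u => f (i, u)⟩, fun S hS => ?_⟩
  by_contra! hlt
  have hle : w ≤ (survivors ⟨fun i u => f (i, u)⟩ S).ncard :=
    Nat.succ_le_of_lt ((Nat.floor_lt (by positivity)).2 hlt)
  obtain ⟨Y, hYS, hYw⟩ := Finset.exists_subset_card_eq
    (s := (Set.toFinite (survivors ⟨fun i u => f (i, u)⟩ S)).toFinset) (n := w)
    (by rwa [← Set.ncard_eq_toFinset_card])
  have hmem : ∀ y ∈ Y, y ∉ S ∧ ∀ i, ∃ y' ∈ S, f (i, y') = f (i, y) := by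
    intro y hy
    have := hYS hy
    rw [Set.Finite.mem_toFinset] at this
    refine ⟨this.1, fun i => ?_⟩
    obtain ⟨y', hy', h⟩ := this.2 (show (i, f (i, y)) ∈ _ from ⟨y, rfl, rfl⟩)
    exact ⟨y', hy', h⟩
  exact hf ⟨S, by simp [hS], Y, by simp [hYw],
    Finset.disjoint_right.2 fun y hy => (hmem y hy).1, fun i y hy => (hmem y hy).2 i⟩

section Estimates

variable {m s n k N : ℕ} {C L z : ℝ}

theorem div_pow_le_of_size (hn : 1 ≤ n) (hz0 : 1 ≤ z) (hL : 1 ≤ L) (hC : 1 ≤ C)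
    (hs : C * L * n * z ≤ s) : (n : ℝ) / s * z ≤ 1 / (C * L) := by
  have hn0 : (0 : ℝ) < n := by exact_mod_cast hn
  have : 0 < C * L * n * z := by positivity
  rw [div_mul_eq_mul_div, div_le_div_iff₀ (by linarith) (by positivity)]
  linarith

theorem small_deficient_estimate (hn : 1 ≤ n) (hm : (m : ℝ) = n * z ^ (k + 2)) (hL : 1 ≤ L)
    (hz : 1 ≤ z) (hC : 12 * 4 ^ N ≤ C) (hCN : 2 * ((N : ℝ) + 1) ≤ C)
    (hs : C * L * n * z ≤ s) (j : ℕ) (hj : 1 ≤ j) (hjX : (j : ℝ) ≤ 2 * (((N : ℝ) + 1) * n * L)) :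
    (m.choose j : ℝ) * (4 ^ (N * j) * ((j : ℝ) / s) ^ ((k + 2) * j)) ≤ (1 / 4) ^ j := by
  have hn0 : (0 : ℝ) < n := by exact_mod_cast hn
  have hj0 : (0 : ℝ) < j := by exact_mod_cast hj
  have h4 : (1 : ℝ) ≤ 4 ^ N := one_le_pow₀ (by norm_num)
  have hC1 : 1 ≤ C := by linarith
  have hs0 : (0 : ℝ) < s := lt_of_lt_of_le (by positivity) hs
  have hq := div_pow_le_of_size hn hz hL hC1 hs
  have hx : (j : ℝ) / n ≤ C * L := by
    rw [div_le_iff₀ hn0]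
    calc (j : ℝ) ≤ 2 * ((N : ℝ) + 1) * (L * n) := by linarith
      _ ≤ C * (L * n) := by gcongr
      _ = _ := by ring
  calc _ ≤ (3 * (m : ℝ) / j) ^ j * (4 ^ (N * j) * ((j : ℝ) / s) ^ ((k + 2) * j)) := by
        gcongr
        exact Nat.choose_le_three_mul_div_pow m j hj
    _ = (3 * 4 ^ N * (((n : ℝ) / s * z) ^ (k + 2) * ((j : ℝ) / n) ^ (k + 1))) ^ j := by
        rw [pow_mul, pow_mul, ← mul_pow, ← mul_pow, hm]
        congr 1
        simp only [div_pow, mul_pow, pow_succ]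
        field_simp
    _ ≤ (3 * 4 ^ N * ((1 / (C * L)) ^ (k + 2) * (C * L) ^ (k + 1))) ^ j := by gcongr
    _ = (3 * 4 ^ N / (C * L)) ^ j := by
        congr 1
        simp only [div_pow, one_pow, pow_succ]
        field_simp
    _ ≤ (1 / 4) ^ j := by
        gcongr ?_ ^ j
        rw [div_le_iff₀ (by positivity)]
        nlinarith

theorem large_deficient_estimate {W : ℕ} (hn : 1 ≤ n) (hm : (m : ℝ) = n * z ^ (k + 2))
    (hL : 1 ≤ L) (hmL : (m : ℝ) = 2 ^ L) (hz : 1 ≤ z) (hC : 240 * 4 ^ N ≤ C)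
    (hs : C * L * n * z ≤ s) (hsm : s ≤ m) (hW : (W : ℝ) ≤ 10 * m * ((n : ℝ) / s) ^ k)
    (j : ℕ) (hj : 1 ≤ j) (hjX : ((N : ℝ) + 1) * n * L ≤ j) (hjs : j ≤ s) :
    (m.choose n : ℝ) * ((W.choose j : ℝ) * (4 ^ (N * j) * (((n : ℝ) / s) ^ j *
      ((j : ℝ) / s) ^ (if j < s then j - N * n else 0)))) ≤ (1 / 4) ^ j := by
  have hn0 : (0 : ℝ) < n := by exact_mod_cast hn
  have hj0 : (0 : ℝ) < j := by exact_mod_cast hj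
  have hj1 : (1 : ℝ) ≤ j := by exact_mod_cast hj
  have h4 : (1 : ℝ) ≤ 4 ^ N := one_le_pow₀ (by norm_num)
  have hC1 : 1 ≤ C := by linarith
  have hs0 : (0 : ℝ) < s := lt_of_lt_of_le (by positivity) hs
  have hs1 : (1 : ℝ) ≤ s := hj1.trans (by exact_mod_cast hjs)
  have hq := div_pow_le_of_size hn hz hL hC1 hs
  have hsm' : (s : ℝ) ≤ m := by exact_mod_cast hsm
  have hD : ((j : ℝ) / s) ^ (if j < s then j - N * n else 0) ≤
      ((j : ℝ) / s) ^ j * (m : ℝ) ^ (N * n) := by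
    refine le_trans ?_ (mul_le_mul_of_nonneg_left (pow_le_pow_left₀ hs0.le hsm' _)
      (by positivity))
    split_ifs with h
    · have hNj : N * n ≤ j := by
        have : (N : ℝ) * n ≤ j := by
          refine le_trans ?_ hjX
          nlinarith [mul_nonneg (Nat.cast_nonneg (α := ℝ) N) hn0.le]
        exact_mod_cast this
      calc ((j : ℝ) / s) ^ (j - N * n) = ((j : ℝ) / s) ^ (j - N * n) * 1 := by ring
        _ ≤ ((j : ℝ) / s) ^ (j - N * n) * (j : ℝ) ^ (N * n) := by
            gcongr
            exact one_le_pow₀ hj1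
        _ = ((j : ℝ) / s) ^ (j - N * n) * ((j : ℝ) / s) ^ (N * n) * (s : ℝ) ^ (N * n) := by
            rw [mul_assoc, ← mul_pow, div_mul_cancel₀ _ hs0.ne']
        _ = _ := by rw [← pow_add, Nat.sub_add_cancel hNj]
    · have : j = s := by omega
      rw [this, div_self hs0.ne']
      simpa using one_le_pow₀ hs1
  have hpow : (m : ℝ) ^ n * (m : ℝ) ^ (N * n) ≤ 2 ^ j := by
    rw [← pow_add, hmL, ← Real.rpow_natCast, ← Real.rpow_mul (by norm_num),
      ← Real.rpow_natCast 2 j]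
    refine Real.rpow_le_rpow_of_exponent_le (by norm_num) (le_trans (le_of_eq ?_) hjX)
    push_cast
    ring
  calc _ ≤ (m : ℝ) ^ n * ((3 * W / j) ^ j * (4 ^ (N * j) * (((n : ℝ) / s) ^ j *
        (((j : ℝ) / s) ^ j * (m : ℝ) ^ (N * n))))) := by
        gcongr
        · exact_mod_cast Nat.choose_le_pow m n
        · exact Nat.choose_le_three_mul_div_pow W j hj
    _ = ((m : ℝ) ^ n * (m : ℝ) ^ (N * n)) *
        ((3 * W / j) ^ j * (4 ^ (N * j) * (((n : ℝ) / s) ^ j * ((j : ℝ) / s) ^ j))) := by ring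
    _ ≤ 2 ^ j * ((3 * (10 * m * ((n : ℝ) / s) ^ k) / j) ^ j *
        (4 ^ (N * j) * (((n : ℝ) / s) ^ j * ((j : ℝ) / s) ^ j))) := by gcongr
    _ = (60 * 4 ^ N * ((n : ℝ) / s * z) ^ (k + 2)) ^ j := by
        rw [pow_mul, ← mul_pow, ← mul_pow, ← mul_pow, ← mul_pow, hm]
        congr 1
        simp only [div_pow, mul_pow, pow_succ]
        field_simp
        ring
    _ ≤ (60 * 4 ^ N * (1 / (C * L)) ^ (k + 2)) ^ j := by gcongr
    _ ≤ (1 / 4) ^ j := by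
        gcongr ?_ ^ j
        have hCL : C ≤ C * L := le_mul_of_one_le_right (by linarith) hL
        have h1 : (1 / (C * L)) ^ (k + 2) ≤ (1 / (C * L)) ^ 1 :=
          pow_le_pow_of_le_one (by positivity)
            (by rw [div_le_one (by positivity)]; linarith) (by omega)
        calc _ ≤ 60 * 4 ^ N * (1 / (C * L)) ^ 1 := by gcongr
          _ ≤ 1 / 4 := by
            rw [pow_one, mul_one_div, div_le_iff₀ (by positivity)]
            linarith

end Estimates

instance BStr.instFintype (t : ℕ) : Fintype (BStr t) :=
  inferInstanceAs (Fintype (Σ i : Fin t, (Fin i.val → Bool)))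

instance BStr.instDecidableEq (t : ℕ) : DecidableEq (BStr t) :=
  inferInstanceAs (DecidableEq (Σ i : Fin t, (Fin i.val → Bool)))

theorem BStr.card_add_one (t : ℕ) : Fintype.card (BStr t) + 1 = 2 ^ t := by
  have h : Fintype.card (BStr t) = ∑ i ∈ Finset.range t, 2 ^ i := by
    rw [Finset.sum_range]
    exact (Fintype.card_sigma (ι := Fin t) (α := fun i => Fin i.val → Bool)).trans (by simp)
  rw [h]
  clear h
  induction t with
  | zero => simp
  | succ t ih => rw [Finset.sum_range_succ]; omega

theorem AdGraph.ncard_Gamma {m s t : ℕ} (f : BStr t × Fin m → Fin s) (T : Finset (Fin m)) :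
    (AdGraph.Gamma ⟨fun σ u => f (σ, u)⟩ (T : Set (Fin m))).ncard =
      ((Finset.univ ×ˢ T).image fun e => (e.1, f e)).card := by
  rw [← Set.ncard_coe_finset]
  congr 1
  ext ⟨σ, v⟩
  simp [AdGraph.Gamma]

/-- Existence of an admissible pair, with the sizes expressed through `z = (m / n) ^ (1 / (k + 2))`
and `L = log₂ m`. -/
theorem exists_admissiblePair_of_size {m s n k : ℕ} {C L z : ℝ} (hn : 1 ≤ n)
    (hm : (m : ℝ) = n * z ^ (k + 2)) (hL : 1 ≤ L) (hmL : (m : ℝ) = 2 ^ L)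
    (hC : 240 * 4 ^ 2 ^ (k + 3) ≤ C) (hs : C * L * n * z ≤ s) (hs' : s ≤ 2 * C * L * n * z)
    (hz : (2 * C * L) ^ (k + 2) ≤ z) :
    ∃ (G₁ : NAGraph m s k) (G₂ : AdGraph m s (k + 3)), AdmissiblePair G₁ G₂ n := by
  have hn0 : (0 : ℝ) < n := by exact_mod_cast hn
  have hn1 : (1 : ℝ) ≤ n := by exact_mod_cast hn
  set N := Fintype.card (BStr (k + 3)) with hN
  have hNp : N + 1 = 2 ^ (k + 3) := BStr.card_add_one (k + 3)
  have hN4 : (4 : ℝ) * 4 ^ N = 4 ^ 2 ^ (k + 3) := by rw [← hNp]; ring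
  have hN0 : (0 : ℝ) ≤ N := by positivity
  have h4 : (1 : ℝ) ≤ 4 ^ N := one_le_pow₀ (by norm_num)
  have hN4' : (N : ℝ) + 1 ≤ 4 ^ N := by
    have : N + 1 ≤ 4 ^ N := Nat.lt_pow_self (by norm_num)
    exact_mod_cast this
  have hC240 : 240 * 4 ^ N ≤ C := by linarith
  have hC1 : 1 ≤ C := by linarith
  have hCN : 2 * ((N : ℝ) + 1) ≤ C := by linarith
  have hCL : L ≤ C * L := le_mul_of_one_le_left (by linarith) hC1
  have hQ1 : 1 ≤ 2 * C * L := by linarith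
  have hQpow : ∀ i ≤ k + 2, (2 * C * L) ^ i ≤ z := fun i hi =>
    (pow_le_pow_right₀ hQ1 hi).trans hz
  have hQz : 2 * C * L ≤ z := by simpa using hQpow 1 (by omega)
  have hz1 : 1 ≤ z := hQ1.trans hQz
  have hs0 : (0 : ℝ) < s := lt_of_lt_of_le (by positivity) hs
  have hsm : s ≤ m := by
    have : (s : ℝ) ≤ m := by
      calc (s : ℝ) ≤ 2 * C * L * n * z := hs'
        _ = n * (2 * C * L * z) := by ring
        _ ≤ n * (z ^ (k + 1) * z) := by
            gcongr
            exact hQz.trans (le_self_pow₀ hz1 (by omega))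
        _ = m := by rw [hm]; ring
    exact_mod_cast this
  have hsnat : 0 < s := by exact_mod_cast hs0
  have hμ : n * L ≤ 10 * (m : ℝ) * ((n : ℝ) / s) ^ k := by
    have h1 : 1 / (2 * C * L) ≤ (n : ℝ) / s * z := by
      rw [div_mul_eq_mul_div, div_le_div_iff₀ (by positivity) hs0]
      linarith
    calc n * L ≤ n * (z * L) := by nlinarith [mul_pos hn0 (by linarith : 0 < L)]
      _ = n * (z * L * ((2 * C * L) ^ k * (1 / (2 * C * L)) ^ k)) := by
          rw [← mul_pow, mul_one_div_cancel (by positivity), one_pow, mul_one]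
      _ ≤ n * (z * z * (1 / (2 * C * L)) ^ k) := by
          have : L * (2 * C * L) ^ k ≤ z := by
            calc L * (2 * C * L) ^ k ≤ (2 * C * L) * (2 * C * L) ^ k := by
                  gcongr
                  linarith
              _ = (2 * C * L) ^ (k + 1) := by ring
              _ ≤ z := hQpow _ (by omega)
          calc _ = n * (z * (L * (2 * C * L) ^ k) * (1 / (2 * C * L)) ^ k) := by ring
            _ ≤ _ := by gcongr
      _ ≤ n * (z * z * ((n : ℝ) / s * z) ^ k) := by gcongr
      _ = 1 * (m : ℝ) * ((n : ℝ) / s) ^ k := by rw [hm]; ring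
      _ ≤ _ := by gcongr; norm_num
  obtain ⟨G₁, hG₁⟩ := exists_survivors_ncard_le m s n k hn (hsnat.trans_le hsm) hsnat (by
    rw [hmL, ← Real.rpow_natCast, ← Real.rpow_mul (by norm_num), ← hmL,
      ← Real.rpow_natCast 2]
    refine Real.rpow_le_rpow_of_exponent_le (by norm_num) ?_
    rw [mul_comm]
    push_cast
    exact hμ.trans (Nat.lt_floor_add_one _).le)
  have : Nonempty (Fin s) := ⟨⟨0, hsnat⟩⟩
  set X : ℝ := ((N : ℝ) + 1) * n * L with hX
  have hXn : ((N : ℝ) + 1) * n ≤ X := le_mul_of_one_le_right (by positivity) hL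
  have hXs : X ≤ s := by
    refine le_trans ?_ hs
    calc X ≤ C * n * L := by
          rw [hX]; gcongr; linarith
      _ ≤ C * n * L * z := le_mul_of_one_le_right (by positivity) hz1
      _ = _ := by ring
  let A : Finset (Fin m) → Finset (Fin m) := fun S => (Set.toFinite (survivors G₁ S)).toFinset
  have hmemA : ∀ S y, y ∈ A S ↔ y ∈ survivors G₁ S := fun S y => Set.Finite.mem_toFinset _
  obtain ⟨f, hf1, hf2⟩ := exists_forall_not_deficient (I := BStr (k + 3)) (α := Fin m)
    (V := Fin s) n ⌊10 * (m : ℝ) * ((n : ℝ) / s) ^ k⌋₊ (k + 2) X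
    (fun j => if j < s then j - N * n else 0) A
    (fun S => Finset.disjoint_right.2 fun y hy => ((hmemA S y).1 hy).1)
    (fun S hS => by
      rw [← Set.ncard_eq_toFinset_card]
      exact Nat.le_floor (hG₁ S hS))
    (fun j hj hjX => by
      rw [Fintype.card_fin, Fintype.card_fin]
      exact small_deficient_estimate hn hm hL hz1 (by linarith) hCN hs j hj hjX)
    (fun j hj hjX hjs => by
      rw [Fintype.card_fin] at hjs
      rw [Fintype.card_fin, Fintype.card_fin]
      exact large_deficient_estimate hn hm hL hmL hz1 hC240 hs hsm
        (Nat.floor_le (by positivity)) j hj hjX hjs)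
  rw [Fintype.card_fin] at hf2
  refine ⟨G₁, ⟨fun σ u => f (σ, u)⟩, hG₁, fun S hS T hT => ?_⟩
  have hk : k + 3 < 2 ^ (k + 3) := Nat.lt_pow_self (by norm_num)
  rw [AdGraph.ncard_Gamma, ← hNp, show N + 1 - (k + 3) = N - (k + 2) by omega]
  refine expansion_of_forall_not_deficient n (k + 2) s X f S (A S) (by omega) (by omega) hS hn
    hXn hXs hf1 (hf2 S hS) T fun y hy => (hT hy).imp id fun hy => ⟨(hmemA S y).2 hy.1, ?_⟩
  obtain ⟨⟨σ, v⟩, ⟨-, y', hy', h'⟩, -, y'', hy'', h''⟩ := hy.2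
  rw [Set.mem_singleton_iff] at hy''
  subst hy''
  exact ⟨σ, y', hy', h'.trans h''.symm⟩

theorem exists_large_log_bound {ε : ℝ} (hε : 0 < ε) : ∃ M : ℕ, ∀ m : ℕ, M ≤ m →
    1 ≤ Real.logb 2 m ∧
      2 + Real.log (Real.logb 2 m) ≤ ε * Real.log 2 * √(Real.logb 2 m) := by
  have hc : 0 < ε * Real.log 2 := mul_pos hε (Real.log_pos (by norm_num))
  have hsqrt : Filter.Tendsto (fun x : ℝ => ε * Real.log 2 / 2 * √x) Filter.atTop Filter.atTop :=
    Real.tendsto_sqrt_atTop.const_mul_atTop (by positivity)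
  have hlog : ∀ᶠ x : ℝ in Filter.atTop, Real.log x ≤ ε * Real.log 2 / 2 * √x := by
    filter_upwards [(isLittleO_log_rpow_atTop (r := 1 / 2) (by norm_num)).def
      (c := ε * Real.log 2 / 2) (by positivity), Filter.eventually_ge_atTop 0] with x hx hx0
    rw [← Real.sqrt_eq_rpow, Real.norm_eq_abs, Real.norm_of_nonneg (Real.sqrt_nonneg x)] at hx
    exact (le_abs_self _).trans hx
  have h : ∀ᶠ x : ℝ in Filter.atTop, 1 ≤ x ∧ 2 + Real.log x ≤ ε * Real.log 2 * √x := by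
    filter_upwards [hlog, hsqrt.eventually_ge_atTop 2, Filter.eventually_ge_atTop 1]
      with x h1 h2 h3
    exact ⟨h3, by linarith⟩
  have hlogb : Filter.Tendsto (fun m : ℕ => Real.logb 2 (m : ℝ)) Filter.atTop Filter.atTop :=
    (Real.tendsto_logb_atTop (by norm_num)).comp tendsto_natCast_atTop_atTop
  exact Filter.eventually_atTop.1 (hlogb.eventually h)

theorem constant_le_exp_exp (k : ℕ) : (240 : ℝ) * 4 ^ 2 ^ (k + 3) ≤
    Real.exp (Real.exp (2 * ((2 * k + 3 : ℕ) : ℝ)) - ((2 * k + 3 : ℕ) : ℝ)) := by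
  have he : (2 : ℝ) ≤ Real.exp 1 := by linarith [Real.add_one_le_exp (1 : ℝ)]
  have he2 : (4 : ℝ) ≤ Real.exp 2 := by
    rw [show (2 : ℝ) = 1 + 1 by norm_num, Real.exp_add]
    nlinarith
  have h16 : (k : ℝ) + 1 ≤ 16 ^ k := by
    have : k + 1 ≤ 16 ^ k := Nat.lt_pow_self (by norm_num)
    exact_mod_cast this
  have h2 : (2 : ℝ) ^ k ≤ 16 ^ k := by gcongr; norm_num
  have hk : (0 : ℝ) ≤ k := by positivity
  have hexp : 64 * (16 : ℝ) ^ k ≤ Real.exp (2 * ((2 * k + 3 : ℕ) : ℝ)) := by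
    rw [mul_comm 2, Real.exp_nat_mul]
    calc 64 * (16 : ℝ) ^ k = 4 ^ (2 * k + 3) := by rw [pow_add, pow_mul]; norm_num; ring
      _ ≤ _ := by gcongr
  have h240 : (240 : ℝ) ≤ Real.exp 10 := by
    calc (240 : ℝ) ≤ 2 ^ 10 := by norm_num
      _ ≤ Real.exp 1 ^ 10 := by gcongr
      _ = Real.exp 10 := by rw [← Real.exp_nat_mul]; norm_num
  calc (240 : ℝ) * 4 ^ 2 ^ (k + 3) ≤ Real.exp 10 * Real.exp 2 ^ 2 ^ (k + 3) := by gcongr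
    _ = Real.exp (10 + 16 * 2 ^ k) := by
        rw [← Real.exp_nat_mul, ← Real.exp_add]
        congr 1
        push_cast
        ring
    _ ≤ _ := by
        apply Real.exp_le_exp.2
        push_cast at hexp ⊢
        linarith

theorem pow_le_rpow_of_log_bound {m ε : ℝ} (k : ℕ) (hm : 0 < m) (hL : 1 ≤ Real.logb 2 m)
    (hLε : 2 + Real.log (Real.logb 2 m) ≤ ε * Real.log 2 * √(Real.logb 2 m))
    (ht : ((2 * k + 3 : ℕ) : ℝ) ≤ 1 / 10 * Real.logb 2 (Real.logb 2 m)) :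
    (2 * Real.exp (Real.exp (2 * ((2 * k + 3 : ℕ) : ℝ)) - ((2 * k + 3 : ℕ) : ℝ)) *
      Real.logb 2 m) ^ (k + 2) ≤ m ^ (ε / ((k + 2 : ℕ) : ℝ)) := by
  set L := Real.logb 2 m with hLdef
  set t : ℕ := 2 * k + 3 with htdef
  have hL0 : 0 < L := by linarith
  set x : ℝ := 2 ^ t with hx
  have hx1 : 1 ≤ x := one_le_pow₀ (by norm_num)
  have hxL : x ^ 10 ≤ L := by
    rw [hx, ← pow_mul, ← Real.rpow_natCast, ← Real.le_logb_iff_rpow_le (by norm_num) hL0]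
    push_cast
    linarith
  have hsqrt : x ^ 5 ≤ √L := by
    apply Real.le_sqrt_of_sq_le
    rwa [← pow_mul]
  have hkx : ((k + 2 : ℕ) : ℝ) ^ 2 ≤ x ^ 2 := by
    have h : k + 2 ≤ 2 ^ t := by
      have : t < 2 ^ t := Nat.lt_pow_self (by norm_num)
      omega
    gcongr
    rw [hx]
    exact_mod_cast h
  have hexp : Real.exp (2 * (t : ℝ)) ≤ x ^ 3 := by
    rw [mul_comm, Real.exp_nat_mul, hx, ← pow_mul, mul_comm t, pow_mul]
    gcongr
    have h1 := Real.exp_one_lt_d9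
    have h2 := Real.exp_pos 1
    rw [show (2 : ℝ) = 1 + 1 by norm_num, Real.exp_add]
    nlinarith
  have hlogL : 0 ≤ Real.log L := Real.log_nonneg hL
  have hlog2 : Real.log 2 ≤ 1 := by
    have := Real.log_le_sub_one_of_pos (by norm_num : (0 : ℝ) < 2)
    linarith
  have hlogm : Real.log m = L * Real.log 2 := by
    rw [hLdef, Real.logb, div_mul_cancel₀ _ (Real.log_pos (by norm_num)).ne']
  set B : ℝ := Real.log 2 + (Real.exp (2 * (t : ℝ)) - t) + Real.log L with hB
  have hbase : 2 * Real.exp (Real.exp (2 * (t : ℝ)) - t) * L = Real.exp B := by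
    rw [hB, Real.exp_add, Real.exp_add, Real.exp_log (by norm_num), Real.exp_log hL0]
  have hBx : B ≤ x ^ 3 + (1 + Real.log L) := by
    have : (0 : ℝ) ≤ t := by positivity
    linarith
  have hmain : ((k + 2 : ℕ) : ℝ) ^ 2 * B ≤ ε * Real.log m := by
    calc ((k + 2 : ℕ) : ℝ) ^ 2 * B ≤ ((k + 2 : ℕ) : ℝ) ^ 2 * (x ^ 3 + (1 + Real.log L)) := by
          gcongr
      _ ≤ x ^ 2 * (x ^ 3 + (1 + Real.log L)) := by gcongr
      _ = x ^ 5 + x ^ 2 * (1 + Real.log L) := by ring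
      _ ≤ x ^ 5 + x ^ 5 * (1 + Real.log L) := by
          have : x ^ 2 ≤ x ^ 5 := pow_le_pow_right₀ hx1 (by norm_num)
          gcongr
      _ = x ^ 5 * (2 + Real.log L) := by ring
      _ ≤ √L * (2 + Real.log L) := by gcongr
      _ ≤ √L * (ε * Real.log 2 * √L) := by gcongr
      _ = ε * Real.log 2 * (√L * √L) := by ring
      _ = ε * Real.log m := by rw [Real.mul_self_sqrt hL0.le, hlogm]; ring
  rw [hbase, ← Real.exp_nat_mul, Real.rpow_def_of_pos hm]
  apply Real.exp_le_exp.2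
  rw [mul_div_assoc', le_div_iff₀ (by positivity)]
  calc ((k + 2 : ℕ) : ℝ) * B * ((k + 2 : ℕ) : ℝ) = ((k + 2 : ℕ) : ℝ) ^ 2 * B := by ring
    _ ≤ _ := by rw [mul_comm (Real.log m)]; exact hmain

/-- For every `ε > 0`, for all sufficiently large `m`, every odd integer `t`
with `3 ≤ t ≤ (1/10)·log₂ log₂ m`, and every integer `n` with `1 ≤ n ≤ m^(1-ε)`,
setting `t₁ = (t-3)/2` and `t₂ = (t+3)/2`, there exist a non-adaptive
`(m,s,t₁)`-graph `G₁` and an adaptive `(m,s,t₂)`-graph `G₂` forming an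
admissible pair for sets of size `n`, with
`s = ⌈exp(e^(2t) - t)·m^(2/(t+1))·n^(1-2/(t+1))·log₂ m⌉`. -/
theorem admissible_pair_exists :
    ∀ ε : ℝ, 0 < ε → ∃ M : ℕ, ∀ m : ℕ, M ≤ m →
      ∀ t : ℕ, Odd t → 3 ≤ t →
        (t : ℝ) ≤ (1 / 10) * Real.logb 2 (Real.logb 2 (m : ℝ)) →
      ∀ n : ℕ, 1 ≤ n → (n : ℝ) ≤ (m : ℝ) ^ ((1 : ℝ) - ε) →
      ∃ (G₁ : NAGraph m
          (⌈Real.exp (Real.exp (2 * (t : ℝ)) - (t : ℝ)) *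
            (m : ℝ) ^ ((2 : ℝ) / ((t : ℝ) + 1)) *
            (n : ℝ) ^ ((1 : ℝ) - 2 / ((t : ℝ) + 1)) * Real.logb 2 (m : ℝ)⌉₊)
          ((t - 3) / 2))
        (G₂ : AdGraph m
          (⌈Real.exp (Real.exp (2 * (t : ℝ)) - (t : ℝ)) *
            (m : ℝ) ^ ((2 : ℝ) / ((t : ℝ) + 1)) *
            (n : ℝ) ^ ((1 : ℝ) - 2 / ((t : ℝ) + 1)) * Real.logb 2 (m : ℝ)⌉₊)
          ((t + 3) / 2)),
        AdmissiblePair G₁ G₂ n := by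
  intro ε hε
  obtain ⟨M, hM⟩ := exists_large_log_bound hε
  refine ⟨M, fun m hm t hodd ht3 htm n hn hnm => ?_⟩
  obtain ⟨hL1, hLε⟩ := hM m hm
  obtain ⟨k, rfl⟩ : ∃ k, t = 2 * k + 3 := by
    obtain ⟨c, rfl⟩ := hodd
    exact ⟨c - 1, by omega⟩
  rw [show (2 * k + 3 - 3) / 2 = k by omega, show (2 * k + 3 + 3) / 2 = k + 3 by omega]
  set L : ℝ := Real.logb 2 m with hL
  have hm0 : (0 : ℝ) < m := by
    rcases Nat.eq_zero_or_pos m with rfl | h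
    · simp [hL] at hL1
      linarith
    · exact_mod_cast h
  have hn0 : (0 : ℝ) < n := by exact_mod_cast hn
  have hexp : (2 : ℝ) / (((2 * k + 3 : ℕ) : ℝ) + 1) = 1 / ((k + 2 : ℕ) : ℝ) := by
    push_cast
    rw [div_eq_div_iff (by positivity) (by positivity)]
    ring
  set C : ℝ := Real.exp (Real.exp (2 * ((2 * k + 3 : ℕ) : ℝ)) - ((2 * k + 3 : ℕ) : ℝ)) with hCdef
  have hC : 240 * 4 ^ 2 ^ (k + 3) ≤ C := constant_le_exp_exp k
  rw [hexp]
  set z : ℝ := ((m : ℝ) / n) ^ (1 / ((k + 2 : ℕ) : ℝ)) with hzdef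
  have hsz : C * (m : ℝ) ^ (1 / ((k + 2 : ℕ) : ℝ)) * (n : ℝ) ^ (1 - 1 / ((k + 2 : ℕ) : ℝ)) * L =
      C * L * n * z := by
    rw [hzdef, Real.div_rpow hm0.le hn0.le, Real.rpow_sub hn0, Real.rpow_one]
    ring
  rw [hsz]
  have hmz : (m : ℝ) = n * z ^ (k + 2) := by
    rw [hzdef, ← Real.rpow_natCast, ← Real.rpow_mul (by positivity),
      one_div_mul_cancel (by positivity), Real.rpow_one, mul_div_cancel₀ _ hn0.ne']
  have hmL : (m : ℝ) = 2 ^ L := (Real.rpow_logb (by norm_num) (by norm_num) hm0).symm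
  have hz : (2 * C * L) ^ (k + 2) ≤ z := by
    have hzm : (m : ℝ) ^ (ε / ((k + 2 : ℕ) : ℝ)) ≤ z := by
      rw [hzdef, div_eq_mul_one_div ε, Real.rpow_mul hm0.le]
      gcongr
      rw [le_div_iff₀ hn0]
      calc (m : ℝ) ^ ε * n ≤ m ^ ε * m ^ (1 - ε) := by gcongr
        _ = m := by rw [← Real.rpow_add hm0]; simp
    exact (pow_le_rpow_of_log_bound k hm0 hL1 hLε htm).trans hzm
  have h4 : (1 : ℝ) ≤ 4 ^ 2 ^ (k + 3) := one_le_pow₀ (by norm_num)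
  have hC1 : 1 ≤ C := by linarith
  have hCL1 : 1 ≤ C * L := one_le_mul_of_one_le_of_one_le hC1 hL1
  have hz1 : 1 ≤ z := le_trans (one_le_pow₀ (by linarith)) hz
  have hbig : 1 ≤ C * L * n * z := one_le_mul_of_one_le_of_one_le
    (one_le_mul_of_one_le_of_one_le hCL1 (by exact_mod_cast hn)) hz1
  refine exists_admissiblePair_of_size hn hmz hL1 hmL hC (Nat.le_ceil _) ?_ hz
  have := Nat.ceil_lt_add_one (by linarith : 0 ≤ C * L * n * z)
  linarith
end
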